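/- For a datum (c,d,B), the quantity D_g(c,d,B) is finite if and only if both the scaling condition Σ_{i=1}^k c_i dim(E_i) = Σ_{j=1}^m d_j dim(E^j) and the dimension condition Σ_{i=1}^k c_i dim(π_{E_i}T) ≤ Σ_{j=1}^m d_j dim(B_j T) for all product-form subspaces T ⊆ E_0 hold; in particular, these conditions imply that each B_j (1≤j≤m) is surjective. Moreover, if the datum (c,d,B) is simple, then it is gaussian-extremizable. -/

import Mathlib

open MeasureTheory LinearMap
open scoped RealInnerProductSpace BigOperators NNReal ENNReal

noncomputable section

namespace FRBL

/-- A positive semidefinite (self-adjoint) operator on a real inner product space. -/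
def PosSemidef {G : Type*} [NormedAddCommGroup G] [InnerProductSpace ℝ G]
    (A : G →ₗ[ℝ] G) : Prop :=
  A.IsSymmetric ∧ ∀ x : G, 0 ≤ ⟪A x, x⟫

/-- A positive definite (self-adjoint) operator on a real inner product space. -/
def PosDef {G : Type*} [NormedAddCommGroup G] [InnerProductSpace ℝ G]
    (A : G →ₗ[ℝ] G) : Prop :=
  A.IsSymmetric ∧ ∀ x : G, x ≠ 0 → 0 < ⟪A x, x⟫

variable {k m : ℕ}
  (E : Fin k → Type*) (F : Fin m → Type*)
  [∀ i, NormedAddCommGroup (E i)] [∀ i, InnerProductSpace ℝ (E i)]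
  [∀ i, FiniteDimensional ℝ (E i)]
  [∀ i, MeasurableSpace (E i)] [∀ i, BorelSpace (E i)]
  [∀ j, NormedAddCommGroup (F j)] [∀ j, InnerProductSpace ℝ (F j)]
  [∀ j, FiniteDimensional ℝ (F j)]
  [∀ j, MeasurableSpace (F j)] [∀ j, BorelSpace (F j)]
  (c : Fin k → ℝ) (d : Fin m → ℝ)
  (B : ∀ i j, E i →ₗ[ℝ] F j)

/-- The pointwise domination hypothesis of the forward-reverse Brascamp-Lieb inequality. -/
def Hyp (f : ∀ i, E i → ℝ≥0) (g : ∀ j, F j → ℝ≥0) : Prop :=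
  ∀ x : ∀ i, E i,
    (∏ i, f i (x i) ^ c i) ≤ ∏ j, g j (∑ i, c i • B i j (x i)) ^ d j

/-- `D₀` is an admissible constant for the forward-reverse Brascamp-Lieb inequality. -/
def IsBound (D₀ : ℝ) : Prop :=
  ∀ (f : ∀ i, E i → ℝ≥0) (g : ∀ j, F j → ℝ≥0),
    (∀ i, Measurable (f i)) → (∀ j, Measurable (g j)) →
    Hyp E F c d B f g →
    (∏ i, (∫⁻ x, (f i x : ℝ≥0∞)) ^ c i) ≤
      ENNReal.ofReal (Real.exp D₀) * ∏ j, (∫⁻ y, (g j y : ℝ≥0∞)) ^ d j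

/-- The best constant `D(c,d,B)` in the forward-reverse Brascamp-Lieb inequality. -/
def D : EReal :=
  sInf {x : EReal | ∃ D₀ : ℝ, x = (D₀ : EReal) ∧ IsBound E F c d B D₀}

/-- The gaussian constraint `Λ_c B* U_d B Λ_c ≤ V_c`, written via quadratic forms. -/
def GaussCon (V : ∀ i, E i →ₗ[ℝ] E i) (U : ∀ j, F j →ₗ[ℝ] F j) : Prop :=
  ∀ x : ∀ i, E i,
    (∑ j, d j * ⟪U j (∑ i, c i • B i j (x i)), ∑ i, c i • B i j (x i)⟫) ≤
      ∑ i, c i * ⟪V i (x i), x i⟫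

/-- The objective functional in the definition of the gaussian constant. -/
def gaussObj (V : ∀ i, E i →ₗ[ℝ] E i) (U : ∀ j, F j →ₗ[ℝ] F j) : ℝ :=
  (∑ j, d j * Real.log (LinearMap.det (U j)) -
    ∑ i, c i * Real.log (LinearMap.det (V i))) / 2

/-- The gaussian best constant `D_g(c,d,B)`. -/
def Dg : EReal :=
  sSup {x : EReal | ∃ (V : ∀ i, E i →ₗ[ℝ] E i) (U : ∀ j, F j →ₗ[ℝ] F j),
    (∀ i, PosDef (V i)) ∧ (∀ j, PosDef (U j)) ∧ GaussCon E F c d B V U ∧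
    x = (gaussObj E F c d V U : EReal)}

/-- The datum `(c,d,B)` is gaussian-extremizable: the supremum defining `D_g` is
finite and attained. -/
def GaussExt : Prop :=
  ∃ (V : ∀ i, E i →ₗ[ℝ] E i) (U : ∀ j, F j →ₗ[ℝ] F j),
    (∀ i, PosDef (V i)) ∧ (∀ j, PosDef (U j)) ∧ GaussCon E F c d B V U ∧
    Dg E F c d B = (gaussObj E F c d V U : EReal)

/-- The canonical linear equivalence between `E₀ = ⊕ᵢ Eᵢ` (as `PiLp 2`) and the pi type. -/
def toPi : PiLp 2 E ≃ₗ[ℝ] ∀ i, E i := WithLp.linearEquiv 2 ℝ (∀ i, E i)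

/-- Orthogonal projection `π_{E_i} : E₀ → E_i`. -/
def projL (i : Fin k) : PiLp 2 E →ₗ[ℝ] E i := (LinearMap.proj i).comp (toPi E).toLinearMap

/-- The embedding `E_i → E₀`. -/
def singleL (i : Fin k) : E i →ₗ[ℝ] PiLp 2 E :=
  (toPi E).symm.toLinearMap.comp (LinearMap.single ℝ E i)

/-- The map `B_j : E₀ → E^j`, `x ↦ ∑ᵢ B_{ij} π_{E_i} x`. -/
def Bop (j : Fin m) : PiLp 2 E →ₗ[ℝ] F j := ∑ i, (B i j).comp (projL E i)

/-- `Λ_c = ⊕ᵢ cᵢ id_{E_i}` as an operator on `E₀`. -/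
def Lam : PiLp 2 E →ₗ[ℝ] PiLp 2 E := ∑ i, c i • (singleL E i).comp (projL E i)

/-- The set `Π(A_1, …, A_k)` of positive semidefinite "couplings". -/
def Coupling (A : ∀ i, E i →ₗ[ℝ] E i) : Set (PiLp 2 E →ₗ[ℝ] PiLp 2 E) :=
  {P | PosSemidef P ∧ ∀ (i : Fin k) (v : E i),
    ⟪P (singleL E i v), singleL E i v⟫ = ⟪A i v, v⟫}

/-- The scaling condition `∑ᵢ cᵢ dim Eᵢ = ∑ⱼ dⱼ dim E^j`. -/
def ScalingCond : Prop :=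
  ∑ i, c i * (Module.finrank ℝ (E i) : ℝ) = ∑ j, d j * (Module.finrank ℝ (F j) : ℝ)

/-- A subspace `T ⊆ E₀` is of product form, i.e. `T = ⊕ᵢ π_{E_i} T`. -/
def ProductForm (T : Submodule ℝ (PiLp 2 E)) : Prop :=
  ∀ x ∈ T, ∀ i, singleL E i (projL E i x) ∈ T

/-- The dimension condition over product-form subspaces. -/
def DimCond : Prop :=
  ∀ T : Submodule ℝ (PiLp 2 E), ProductForm E T →
    (∑ i, c i * (Module.finrank ℝ (T.map (projL E i)) : ℝ)) ≤
      ∑ j, d j * (Module.finrank ℝ (T.map (Bop E F B j)) : ℝ)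

/-- A critical subspace. -/
def IsCritical (T : Submodule ℝ (PiLp 2 E)) : Prop :=
  T ≠ ⊥ ∧ T ≠ ⊤ ∧ ProductForm E T ∧
    ∑ i, c i * (Module.finrank ℝ (T.map (projL E i)) : ℝ) =
      ∑ j, d j * (Module.finrank ℝ (T.map (Bop E F B j)) : ℝ)

/-- The datum is simple if it has no critical subspace. -/
def Simple : Prop := ∀ T : Submodule ℝ (PiLp 2 E), ¬ IsCritical E F c d B T

end FRBL

namespace FRBL

/-- `log det` with value `−∞` on operators with non-positive determinant
(in particular on singular positive-semidefinite operators). -/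
def elogdet {G : Type*} [AddCommGroup G] [Module ℝ G] (A : G →ₗ[ℝ] G) : EReal :=
  if 0 < LinearMap.det A then ((Real.log (LinearMap.det A) : ℝ) : EReal) else ⊥

variable {k m : ℕ}
  (E : Fin k → Type*) (F : Fin m → Type*)
  [∀ i, NormedAddCommGroup (E i)] [∀ i, InnerProductSpace ℝ (E i)]
  [∀ i, FiniteDimensional ℝ (E i)]
  [∀ j, NormedAddCommGroup (F j)] [∀ j, InnerProductSpace ℝ (F j)]
  [∀ j, FiniteDimensional ℝ (F j)]
  (c : Fin k → ℝ) (d : Fin m → ℝ)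
  (B : ∀ i j, E i →ₗ[ℝ] F j)

/-- The map `Q_j := B_j Λ_c : E₀ → E^j`. -/
def BLam (j : Fin m) : PiLp 2 E →ₗ[ℝ] F j := (Bop E F B j).comp (Lam E c)

/-- The optimality condition of Theorem 2 (structure of gaussian extremizers):
each `B_j Λ_c Π Λ_c B_j*` is invertible and
`∑ⱼ dⱼ Λ_c B_j* (B_j Λ_c Π Λ_c B_j*)⁻¹ B_j Λ_c ≤ V_c` in the quadratic-form sense. -/
def ExtCond (V : ∀ i, E i →ₗ[ℝ] E i) (P : PiLp 2 E →ₗ[ℝ] PiLp 2 E) : Prop :=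
  (∀ j, IsUnit ((BLam E F c B j) ∘ₗ P ∘ₗ LinearMap.adjoint (BLam E F c B j))) ∧
  ∀ x : PiLp 2 E,
    (∑ j, d j * ⟪Ring.inverse ((BLam E F c B j) ∘ₗ P ∘ₗ LinearMap.adjoint (BLam E F c B j))
        (BLam E F c B j x), BLam E F c B j x⟫) ≤
      ∑ i, c i * ⟪V i (projL E i x), projL E i x⟫

/-- A geometric datum. -/
def Geometric : Prop :=
  ScalingCond E F c d ∧
  ∃ S ∈ Coupling E (fun i => (LinearMap.id : E i →ₗ[ℝ] E i)),
    (∀ j, (BLam E F c B j) ∘ₗ S ∘ₗ LinearMap.adjoint (BLam E F c B j) = LinearMap.id) ∧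
    ∀ x : PiLp 2 E, (∑ j, d j * ⟪BLam E F c B j x, BLam E F c B j x⟫) ≤ ⟪Lam E c x, x⟫

/-- Equivalence of data: `B'_j = C_j⁻¹ B_j C⁻¹` for invertible `C, C_j`. -/
def EquivData (B' : ∀ i j, E i →ₗ[ℝ] F j) : Prop :=
  ∃ (C : PiLp 2 E ≃ₗ[ℝ] PiLp 2 E) (Cj : ∀ j, F j ≃ₗ[ℝ] F j),
    ∀ j, Bop E F B' j =
      ((Cj j).symm.toLinearMap ∘ₗ Bop E F B j) ∘ₗ C.symm.toLinearMap

/-- `V_c = ⊕ᵢ cᵢ Vᵢ` as an operator on `E₀`. -/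
def blockDiag (V : ∀ i, E i →ₗ[ℝ] E i) : PiLp 2 E →ₗ[ℝ] PiLp 2 E :=
  ∑ i, c i • ((singleL E i) ∘ₗ (V i)) ∘ₗ (projL E i)

/-- `Θ = V_c − ∑ⱼ dⱼ Λ_c B_j* U_j B_j Λ_c`. -/
def Theta (V : ∀ i, E i →ₗ[ℝ] E i) (U : ∀ j, F j →ₗ[ℝ] F j) :
    PiLp 2 E →ₗ[ℝ] PiLp 2 E :=
  blockDiag E c V -
    ∑ j, d j • (LinearMap.adjoint (BLam E F c B j) ∘ₗ (U j)) ∘ₗ (BLam E F c B j)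

end FRBL

namespace FRBL

/-- Borel structure on submodules (inherited from the ambient space). -/
instance subBorel {G : Type*} [AddCommGroup G] [Module ℝ G] [TopologicalSpace G]
    [MeasurableSpace G] [BorelSpace G] (T : Submodule ℝ G) : BorelSpace ↥T :=
  Subtype.borelSpace (T : Set G)

/-- The maximal dimension of a subspace on which the self-adjoint operator `Q` is positive
definite; by Sylvester's law of inertia this is the number of positive eigenvalues of `Q`,
counted with multiplicity. -/
def posIndex {H : Type*} [NormedAddCommGroup H] [InnerProductSpace ℝ H]
    (Q : H →ₗ[ℝ] H) : ℕ :=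
  sSup {r : ℕ | ∃ W : Submodule ℝ H,
    (∀ x ∈ W, x ≠ 0 → 0 < ⟪Q x, x⟫) ∧ Module.finrank ℝ W = r}

/-- The standard gaussian probability measure on a Euclidean space. -/
def stdGaussian (G : Type*) [NormedAddCommGroup G] [InnerProductSpace ℝ G]
    [FiniteDimensional ℝ G] [MeasurableSpace G] [BorelSpace G] :
    Measure G :=
  volume.withDensity fun x =>
    ENNReal.ofReal ((2 * Real.pi) ^ (-(Module.finrank ℝ G : ℝ) / 2) *
      Real.exp (-‖x‖ ^ 2 / 2))

/-- `K_s = (|s|^{1/s} |s'|^{1/s'})^{1/2}`. -/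
def Kconst (s s' : ℝ) : ℝ := Real.sqrt (|s| ^ (1 / s) * |s'| ^ (1 / s'))

variable {k m : ℕ}
  (E : Fin k → Type*) (F : Fin m → Type*)
  [∀ i, NormedAddCommGroup (E i)] [∀ i, InnerProductSpace ℝ (E i)]
  [∀ i, FiniteDimensional ℝ (E i)]
  [∀ j, NormedAddCommGroup (F j)] [∀ j, InnerProductSpace ℝ (F j)]
  [∀ j, FiniteDimensional ℝ (F j)]
  (c : Fin k → ℝ) (d : Fin m → ℝ)
  (B : ∀ i j, E i →ₗ[ℝ] F j)

/-- The objective functional `∑ⱼ dⱼ log det Uⱼ − ∑ᵢ cᵢ log det Vᵢ`. -/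
def objective (V : ∀ i, E i →ₗ[ℝ] E i) (U : ∀ j, F j →ₗ[ℝ] F j) : ℝ :=
  ∑ j, d j * Real.log (LinearMap.det (U j)) - ∑ i, c i * Real.log (LinearMap.det (V i))

/-- Feasibility for the optimization problem defining `D_g`: positive definiteness
together with the constraint `Θ ≥ 0`. -/
def Admissible (V : ∀ i, E i →ₗ[ℝ] E i) (U : ∀ j, F j →ₗ[ℝ] F j) : Prop :=
  (∀ i, PosDef (V i)) ∧ (∀ j, PosDef (U j)) ∧ PosSemidef (Theta E F c d B V U)

/-- Global maximality in the optimization problem defining `D_g`. -/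
def IsGlobalMax (V : ∀ i, E i →ₗ[ℝ] E i) (U : ∀ j, F j →ₗ[ℝ] F j) : Prop :=
  Admissible E F c d B V U ∧
    ∀ V' U', Admissible E F c d B V' U' →
      objective E F c d V' U' ≤ objective E F c d V U

/-- Local maximality in the optimization problem defining `D_g`. -/
def IsLocalMax (V : ∀ i, E i →ₗ[ℝ] E i) (U : ∀ j, F j →ₗ[ℝ] F j) : Prop :=
  Admissible E F c d B V U ∧
    ∃ ε : ℝ, 0 < ε ∧
      ∀ V' U', Admissible E F c d B V' U' →
        (∀ i, ‖LinearMap.toContinuousLinearMap (V' i - V i)‖ < ε) →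
        (∀ j, ‖LinearMap.toContinuousLinearMap (U' j - U j)‖ < ε) →
        objective E F c d V' U' ≤ objective E F c d V U

end FRBL

namespace FRBL

section Operators

variable {G : Type*} [NormedAddCommGroup G] [InnerProductSpace ℝ G]

lemma PosDef.posSemidef {A : G →ₗ[ℝ] G} (hA : PosDef A) : PosSemidef A := by
  refine ⟨hA.1, fun x => ?_⟩
  rcases eq_or_ne x 0 with rfl | hx
  · simp
  · exact (hA.2 x hx).le

lemma PosDef.smul {A : G →ₗ[ℝ] G} (hA : PosDef A) {t : ℝ} (ht : 0 < t) : PosDef (t • A) := by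
  refine ⟨fun x y => ?_, fun x hx => ?_⟩
  · simp [inner_smul_left, inner_smul_right, hA.1 x y]
  · simpa [inner_smul_left] using mul_pos ht (hA.2 x hx)

/-- Cauchy–Schwarz inequality for the form of a positive semidefinite operator. -/
lemma PosSemidef.inner_sq_le {A : G →ₗ[ℝ] G} (hA : PosSemidef A) (x y : G) :
    ⟪A x, y⟫ ^ 2 ≤ ⟪A x, x⟫ * ⟪A y, y⟫ := by
  have hquad : ∀ t : ℝ, 0 ≤ ⟪A x, x⟫ * (t * t) + (2 * ⟪A x, y⟫) * t + ⟪A y, y⟫ := by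
    intro t
    have h := hA.2 (t • x + y)
    have hs : ⟪A y, x⟫ = ⟪A x, y⟫ := by rw [hA.1 y x, real_inner_comm]
    simp only [map_add, map_smul, inner_add_left, inner_add_right, inner_smul_left,
      inner_smul_right, RCLike.conj_to_real, hs] at h
    linarith
  have h := discrim_le_zero hquad
  rw [discrim] at h
  linarith

lemma PosSemidef.abs_inner_le {A : G →ₗ[ℝ] G} (hA : PosSemidef A) (x y : G) :
    |⟪A x, y⟫| ≤ √⟪A x, x⟫ * √⟪A y, y⟫ := by
  rw [← Real.sqrt_mul (hA.2 x)]
  exact Real.abs_le_sqrt (hA.inner_sq_le x y)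

lemma PosSemidef.norm_apply_le {A : G →ₗ[ℝ] G} (hA : PosSemidef A) {R : ℝ}
    (hR : ∀ x, ⟪A x, x⟫ ≤ R * ‖x‖ ^ 2) (hR0 : 0 ≤ R) (x : G) : ‖A x‖ ≤ R * ‖x‖ := by
  have h := hA.inner_sq_le x (A x)
  rw [real_inner_self_eq_norm_sq] at h
  have h2 : ⟪A x, x⟫ * ⟪A (A x), A x⟫ ≤ (R * ‖x‖ ^ 2) * (R * ‖A x‖ ^ 2) :=
    mul_le_mul (hR x) (hR _) (hA.2 _) (by positivity)
  rcases eq_or_lt_of_le (norm_nonneg (A x)) with h0 | h0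
  · rw [← h0]; positivity
  · refine le_of_sq_le_sq ?_ (by positivity)
    refine le_of_mul_le_mul_right ?_ (pow_pos h0 2)
    nlinarith

/-- A weak form of Hadamard's inequality for the form of a positive semidefinite operator. -/
lemma PosSemidef.det_mul_sq_le {κ : Type*} [Fintype κ] [DecidableEq κ] {A : G →ₗ[ℝ] G}
    (hA : PosSemidef A) (f : OrthonormalBasis κ ℝ G) (v : κ → G) :
    LinearMap.det A * (f.toBasis.toMatrix v).det ^ 2 ≤
      (Fintype.card κ).factorial * ∏ a, ⟪A (v a), v a⟫ := by
  set M := f.toBasis.toMatrix v with hM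
  have hgram : (Matrix.of fun a b => ⟪A (v a), v b⟫) =
      (LinearMap.toMatrix f.toBasis f.toBasis A * M).transpose * M := by
    ext a b
    have h1 : ∀ p, (LinearMap.toMatrix f.toBasis f.toBasis A * M) p a = ⟪f p, A (v a)⟫ := by
      intro p
      have h2 := congrFun (LinearMap.toMatrix_mulVec_repr f.toBasis f.toBasis A (v a)) p
      simpa [Matrix.mulVec, dotProduct, Matrix.mul_apply, hM, Module.Basis.toMatrix_apply,
        OrthonormalBasis.repr_apply_apply] using h2
    have h3 : ∀ p, M p b = ⟪f p, v b⟫ := by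
      intro p
      simp [hM, Module.Basis.toMatrix_apply, OrthonormalBasis.repr_apply_apply]
    simp only [Matrix.of_apply, Matrix.mul_apply, Matrix.transpose_apply] at h1 ⊢
    simp only [h1, h3]
    rw [← f.sum_inner_mul_inner]
    exact Finset.sum_congr rfl fun p _ => by rw [real_inner_comm]
  have hdet : (Matrix.of fun a b => ⟪A (v a), v b⟫).det = LinearMap.det A * M.det ^ 2 := by
    rw [hgram, Matrix.det_mul, Matrix.det_transpose, Matrix.det_mul, LinearMap.det_toMatrix]
    ring
  rw [← hdet, Matrix.det_apply]
  calc ∑ σ : Equiv.Perm κ, Equiv.Perm.sign σ • ∏ i, Matrix.of (fun a b => ⟪A (v a), v b⟫) (σ i) i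
      ≤ ∑ _σ : Equiv.Perm κ, ∏ a, ⟪A (v a), v a⟫ := by
        refine Finset.sum_le_sum fun σ _ => ?_
        calc _ ≤ |Equiv.Perm.sign σ • ∏ i, Matrix.of (fun a b => ⟪A (v a), v b⟫) (σ i) i| :=
              le_abs_self _
          _ = ∏ i, |⟪A (v (σ i)), v i⟫| := by
              rw [← Finset.abs_prod]
              rcases Int.units_eq_one_or (Equiv.Perm.sign σ) with h | h <;> simp [h]
          _ ≤ ∏ i, (√⟪A (v (σ i)), v (σ i)⟫ * √⟪A (v i), v i⟫) :=
              Finset.prod_le_prod (fun _ _ => abs_nonneg _) fun _ _ => hA.abs_inner_le _ _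
          _ = ∏ a, ⟪A (v a), v a⟫ := by
              rw [Finset.prod_mul_distrib,
                Equiv.prod_comp σ (fun i => √⟪A (v i), v i⟫), ← Finset.prod_mul_distrib]
              exact Finset.prod_congr rfl fun a _ => Real.mul_self_sqrt (hA.2 _)
    _ = _ := by simp [Fintype.card_perm]

lemma det_eq_prod_of_eigen {κ : Type*} [Fintype κ] {A : G →ₗ[ℝ] G}
    (f : OrthonormalBasis κ ℝ G) (μ : κ → ℝ) (h : ∀ a, A (f a) = μ a • f a) :
    LinearMap.det A = ∏ a, μ a := by
  classical
  rw [← LinearMap.det_toMatrix f.toBasis]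
  have : LinearMap.toMatrix f.toBasis f.toBasis A = Matrix.diagonal μ := by
    ext a b
    simp [LinearMap.toMatrix_apply, h, Matrix.diagonal_apply]
    grind
  rw [this, Matrix.det_diagonal]

lemma inner_apply_eq_sum_of_eigen {κ : Type*} [Fintype κ] {A : G →ₗ[ℝ] G}
    (f : OrthonormalBasis κ ℝ G) (μ : κ → ℝ) (h : ∀ a, A (f a) = μ a • f a) (x : G) :
    ⟪A x, x⟫ = ∑ a, μ a * ⟪f a, x⟫ ^ 2 := by
  conv_lhs => rw [← f.sum_repr' x]
  simp only [map_sum, map_smul, h]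
  rw [f.sum_repr' x, sum_inner]
  refine Finset.sum_congr rfl fun a _ => ?_
  simp only [inner_smul_left, RCLike.conj_to_real]
  ring

lemma norm_sq_eq_sum {κ : Type*} [Fintype κ] (f : OrthonormalBasis κ ℝ G) (x : G) :
    ‖x‖ ^ 2 = ∑ a, ⟪f a, x⟫ ^ 2 := by
  simpa using inner_apply_eq_sum_of_eigen (A := LinearMap.id) f (fun _ => 1) (by simp) x

variable [FiniteDimensional ℝ G]

lemma PosDef.exists_eigen {A : G →ₗ[ℝ] G} (hA : PosDef A) :
    ∃ (f : OrthonormalBasis (Fin (Module.finrank ℝ G)) ℝ G) (μ : Fin (Module.finrank ℝ G) → ℝ),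
      (∀ a, 0 < μ a) ∧ ∀ a, A (f a) = μ a • f a := by
  have h : ∀ a, A (hA.1.eigenvectorBasis rfl a) =
      hA.1.eigenvalues rfl a • hA.1.eigenvectorBasis rfl a := fun a =>
    hA.1.apply_eigenvectorBasis rfl a
  refine ⟨hA.1.eigenvectorBasis rfl, hA.1.eigenvalues rfl, fun a => ?_, h⟩
  have hpos := hA.2 _ ((hA.1.eigenvectorBasis rfl).toBasis.ne_zero a)
  simpa [h, inner_smul_left] using hpos

lemma PosDef.det_pos {A : G →ₗ[ℝ] G} (hA : PosDef A) : 0 < LinearMap.det A := by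
  obtain ⟨f, μ, hμ, h⟩ := hA.exists_eigen
  rw [det_eq_prod_of_eigen f μ h]
  exact Finset.prod_pos fun a _ => hμ a

lemma PosSemidef.posDef {A : G →ₗ[ℝ] G} (hA : PosSemidef A) (hdet : LinearMap.det A ≠ 0) :
    PosDef A := by
  refine ⟨hA.1, fun x hx => lt_of_le_of_ne (hA.2 x) fun h0 => hx ?_⟩
  have h1 := hA.inner_sq_le x (A x)
  rw [← h0, zero_mul, real_inner_self_eq_norm_sq] at h1
  have h2 : A x = 0 := by
    have : ‖A x‖ ^ 2 = 0 := by nlinarith [sq_nonneg (‖A x‖ ^ 2)]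
    simpa using this
  have h3 := LinearMap.ker_eq_bot'.1 ((LinearMap.isUnit_iff_ker_eq_bot A).1
    ((LinearMap.isUnit_iff_isUnit_det A).2 hdet.isUnit))
  exact h3 x h2

lemma PosSemidef.det_le {A : G →ₗ[ℝ] G} (hA : PosSemidef A) {R : ℝ}
    (hR : ∀ x, ⟪A x, x⟫ ≤ R * ‖x‖ ^ 2) :
    LinearMap.det A ≤ (Module.finrank ℝ G).factorial * R ^ Module.finrank ℝ G := by
  have h := hA.det_mul_sq_le (stdOrthonormalBasis ℝ G) (stdOrthonormalBasis ℝ G)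
  have h1 : (stdOrthonormalBasis ℝ G).toBasis.toMatrix (stdOrthonormalBasis ℝ G) = 1 := by
    simpa using (stdOrthonormalBasis ℝ G).toBasis.toMatrix_self
  rw [h1] at h
  simp only [Matrix.det_one, one_pow, mul_one, Fintype.card_fin] at h
  refine h.trans (mul_le_mul_of_nonneg_left ?_ (by positivity))
  calc _ ≤ ∏ _a : Fin (Module.finrank ℝ G), R :=
        Finset.prod_le_prod (fun a _ => hA.2 _) fun a _ => by
          simpa using hR (stdOrthonormalBasis ℝ G a)
    _ = _ := by simp

/-- The operator acting as `ε` on a subspace and as the identity on its orthogonal complement. -/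
def stretch (S : Submodule ℝ G) (ε : ℝ) : G →ₗ[ℝ] G :=
  LinearMap.id + (ε - 1) • S.starProjection.toLinearMap

lemma inner_stretch (S : Submodule ℝ G) (ε : ℝ) (x : G) :
    ⟪stretch S ε x, x⟫ = ε * ‖S.starProjection x‖ ^ 2 + ‖x - S.starProjection x‖ ^ 2 := by
  have h1 : ⟪S.starProjection x, x⟫ = ‖S.starProjection x‖ ^ 2 := by
    rw [← real_inner_self_eq_norm_sq, S.inner_starProjection_left_eq_right,
      S.inner_starProjection_left_eq_right,
      S.starProjection_eq_self_iff.2 (S.starProjection_apply_mem x)]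
  rw [norm_sub_sq_real, real_inner_comm _ x, h1]
  simp [stretch, inner_add_left, inner_smul_left, h1]
  ring

lemma posDef_stretch (S : Submodule ℝ G) {ε : ℝ} (hε : 0 < ε) : PosDef (stretch S ε) := by
  refine ⟨fun x y => ?_, fun x hx => ?_⟩
  · have : ⟪S.starProjection x, y⟫ = ⟪x, S.starProjection y⟫ :=
      S.inner_starProjection_left_eq_right x y
    simp [stretch, inner_add_left, inner_add_right, inner_smul_left, inner_smul_right, this]
  · rw [inner_stretch]
    by_cases h : S.starProjection x = 0
    · simpa only [h, sub_zero, norm_zero, ne_eq, OfNat.ofNat_ne_zero, not_false_eq_true, zero_pow,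
        mul_zero, zero_add] using pow_pos (norm_pos_iff.2 hx) 2
    · have := norm_pos_iff.2 h
      positivity

lemma det_stretch (S : Submodule ℝ G) (ε : ℝ) :
    LinearMap.det (stretch S ε) = ε ^ Module.finrank ℝ S := by
  have hS : S ≤ S.comap (stretch S ε) := fun x hx => by
    simpa [stretch] using S.add_mem hx (S.smul_mem _ (S.starProjection_apply_mem x))
  rw [LinearMap.det_eq_det_mul_det S _ hS]
  have h1 : S.mapQ S (stretch S ε) hS = LinearMap.id := by
    ext x
    simp only [LinearMap.comp_apply, Submodule.mapQ_apply, Submodule.mkQ_apply, LinearMap.id_apply]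
    rw [Submodule.Quotient.eq]
    simpa [stretch] using (S.smul_mem _ (S.starProjection_apply_mem x))
  have h2 : (stretch S ε).restrict hS = ε • LinearMap.id := by
    ext x
    have : S.starProjection (x : G) = x := S.starProjection_eq_self_iff.2 x.2
    simp [LinearMap.restrict_apply, stretch, this, sub_smul]
  rw [h1, h2]
  simp

end Operators

end FRBL

namespace FRBL

section Combinatorics

/-- Summation by parts against a monotone sequence, with a gap in the partial sums. -/
lemma sum_range_mul_le_of_partial_sums (w μ : ℕ → ℝ) (hμ : Monotone μ) (δ : ℝ) (M : ℕ)
    (h : ∀ r, r < M → δ ≤ ∑ n ∈ Finset.range (r + 1), w n) :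
    ∑ n ∈ Finset.range (M + 1), w n * μ n ≤
      (∑ n ∈ Finset.range (M + 1), w n) * μ M - δ * (μ M - μ 0) := by
  induction M with
  | zero => simp
  | succ M ih =>
    rw [Finset.sum_range_succ, Finset.sum_range_succ _ (M + 1)]
    have h1 := ih fun r hr => h r (by omega)
    have h2 := mul_nonneg (sub_nonneg.2 (h M (by omega))) (sub_nonneg.2 (hμ (Nat.le_succ M)))
    simp only [Nat.succ_eq_add_one] at h2
    nlinarith

lemma sum_fin_mul_le_of_partial_sums {N : ℕ} (w μ : Fin N → ℝ) (hμ : Monotone μ) {δ : ℝ}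
    (hδ : 0 ≤ δ)
    (h : ∀ r, 0 < r → r < N → δ ≤ ∑ n with n.val < r, w n) (h0 : ∑ n, w n = 0) :
    ∑ n, w n * μ n ≤ 0 ∧ ∀ a b, ∑ n, w n * μ n ≤ -(δ * (μ a - μ b)) := by
  rcases N with _ | M
  · exact ⟨by simp, fun a => a.elim0⟩
  set w' : ℕ → ℝ := fun n => if hn : n < M + 1 then w ⟨n, hn⟩ else 0 with hw'
  set μ' : ℕ → ℝ := fun n => μ ⟨min n M, by omega⟩ with hμ'
  have hmono : Monotone μ' := fun a b hab => hμ (by simp only [Fin.mk_le_mk]; omega)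
  have e1 : ∀ n : Fin (M + 1), w' n = w n := fun n => by simp only [hw', n.2, dite_true, Fin.eta]
  have e2 : ∀ n : Fin (M + 1), μ' n = μ n := fun n => by
    simp only [hμ']
    congr 1
    ext
    simp only []
    omega
  have hpart : ∀ r, r ≤ M + 1 → ∑ n ∈ Finset.range r, w' n = ∑ n with n.val < r, w n := by
    intro r hr
    have hfilter : Finset.range r = (Finset.range (M + 1)).filter (· < r) := by
      ext n
      simp only [Finset.mem_range, Finset.mem_filter]
      omega
    rw [hfilter, Finset.sum_filter,
      ← Fin.sum_univ_eq_sum_range (fun n => if n < r then w' n else 0), Finset.sum_filter]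
    simp only [e1]
  have key := sum_range_mul_le_of_partial_sums w' μ' hmono δ M fun r hr => by
    rw [hpart _ (by omega)]
    exact h _ (by omega) (by omega)
  have s1 : ∑ n ∈ Finset.range (M + 1), w' n = 0 := by
    rw [← Fin.sum_univ_eq_sum_range]
    simpa [e1] using h0
  rw [s1, ← Fin.sum_univ_eq_sum_range (fun n => w' n * μ' n), zero_mul, zero_sub] at key
  simp only [e1, e2] at key
  have hmax : ∀ a, μ a ≤ μ' M := fun a => hμ (by
    rw [Fin.le_def]; simp only [min_self]; omega)
  have hmin : ∀ a, μ' 0 ≤ μ a := fun a => hμ (by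
    rw [Fin.le_def]; simp)
  have hb : ∀ a b, ∑ n, w n * μ n ≤ -(δ * (μ a - μ b)) := fun a b => by
    refine key.trans (neg_le_neg (mul_le_mul_of_nonneg_left ?_ hδ))
    linarith [hmax a, hmin b]
  refine ⟨by simpa using hb 0 0, hb⟩

lemma exists_pos_gap {X : Type*} [Finite X] (f : X → ℝ) :
    ∃ δ, 0 < δ ∧ ∀ x, 0 < f x → δ ≤ f x := by
  classical
  have := Fintype.ofFinite X
  rcases (Finset.univ.filter fun x => 0 < f x).eq_empty_or_nonempty with h | h
  · refine ⟨1, one_pos, fun x hx => ?_⟩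
    have : x ∈ Finset.univ.filter fun x => 0 < f x := by simpa using hx
    simp [h] at this
  · obtain ⟨x, hx, hmin⟩ := Finset.exists_min_image _ f h
    exact ⟨f x, (Finset.mem_filter.1 hx).2, fun y hy => hmin y (by simpa using hy)⟩

end Combinatorics

section Greedy

variable {G : Type*} [NormedAddCommGroup G] [InnerProductSpace ℝ G]

open Classical in
/-- Indices of the vectors of a finite sequence not in the span of their predecessors. -/
def greedy {N : ℕ} (v : Fin N → G) : Finset (Fin N) :=
  Finset.univ.filter fun n => v n ∉ Submodule.span ℝ (v '' {m | m < n})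

variable [FiniteDimensional ℝ G]

lemma greedy_spec {N : ℕ} (v : Fin N → G) (r : ℕ) (hr : r ≤ N) :
    Submodule.span ℝ (v '' {m | m.val < r ∧ m ∈ greedy v}) =
        Submodule.span ℝ (v '' {m | m.val < r}) ∧
      ((greedy v).filter fun n => n.val < r).card =
        Module.finrank ℝ (Submodule.span ℝ (v '' {m | m.val < r})) := by
  induction r with
  | zero =>
    have : {m : Fin N | m.val < 0} = ∅ := by ext; simp
    rw [this, Set.image_empty, Submodule.span_empty, finrank_bot]
    simp
  | succ r ih =>
    obtain ⟨ih1, ih2⟩ := ih (by omega)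
    set a : Fin N := ⟨r, by omega⟩ with ha
    have hlt : {m : Fin N | m < a} = {m | m.val < r} := by ext; simp [ha, Fin.lt_def]
    have hins : {m : Fin N | m.val < r + 1} = insert a {m | m.val < r} := by
      ext m
      simp [ha, Fin.ext_iff]
      omega
    have hspan : Submodule.span ℝ (v '' {m : Fin N | m.val < r + 1}) =
        Submodule.span ℝ (v '' {m | m.val < r}) ⊔ Submodule.span ℝ {v a} := by
      rw [hins, Set.image_insert_eq, Submodule.span_insert, sup_comm]
    by_cases hmem : v a ∈ Submodule.span ℝ (v '' {m | m.val < r})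
    · have hag : a ∉ greedy v := by simp [greedy, hlt, hmem]
      have h1 : {m : Fin N | m.val < r + 1 ∧ m ∈ greedy v} =
          {m | m.val < r ∧ m ∈ greedy v} := by
        ext m
        have : m.val = r → m ∉ greedy v := fun h => by
          rwa [show m = a from Fin.ext h]
        simp only [Set.mem_ofPred_eq]
        grind
      have h2 : ((greedy v).filter fun n => n.val < r + 1) =
          (greedy v).filter fun n => n.val < r := by
        ext m
        simpa [and_comm] using Set.ext_iff.1 h1 m
      have h3 : Submodule.span ℝ (v '' {m : Fin N | m.val < r + 1}) =
          Submodule.span ℝ (v '' {m | m.val < r}) := by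
        rw [hspan, sup_eq_left, Submodule.span_singleton_le_iff_mem]
        exact hmem
      rw [h1, h2, h3]
      exact ⟨ih1, ih2⟩
    · have hag : a ∈ greedy v := by simp [greedy, hlt, hmem]
      have h1 : {m : Fin N | m.val < r + 1 ∧ m ∈ greedy v} =
          insert a {m | m.val < r ∧ m ∈ greedy v} := by
        ext m
        have h4 : m.val = r ↔ m = a := by simp [ha, Fin.ext_iff]
        simp only [Set.mem_ofPred_eq, Set.mem_insert_iff, ← h4]
        have : m.val = r → m ∈ greedy v := fun h => by rwa [h4.1 h]
        grind
      have h2 : ((greedy v).filter fun n => n.val < r + 1) =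
          insert a ((greedy v).filter fun n => n.val < r) := by
        ext m
        simpa [and_comm] using Set.ext_iff.1 h1 m
      refine ⟨?_, ?_⟩
      · rw [h1, Set.image_insert_eq, Submodule.span_insert, ih1, hspan, sup_comm]
      · rw [h2, Finset.card_insert_of_notMem (by simp [ha]), ih2, hspan,
          Submodule.finrank_sup_span_singleton hmem]

lemma card_greedy_lt {N : ℕ} (v : Fin N → G) {r : ℕ} (hr : r ≤ N) :
    ((greedy v).filter fun n => n.val < r).card =
      Module.finrank ℝ (Submodule.span ℝ (v '' {m | m.val < r})) :=
  (greedy_spec v r hr).2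

lemma span_greedy {N : ℕ} (v : Fin N → G) :
    Submodule.span ℝ (v '' (greedy v : Set (Fin N))) = Submodule.span ℝ (Set.range v) := by
  simpa using (greedy_spec v N le_rfl).1

lemma card_greedy {N : ℕ} (v : Fin N → G) :
    (greedy v).card = Module.finrank ℝ (Submodule.span ℝ (Set.range v)) := by
  have h : {m : Fin N | m.val < N} = Set.univ := by ext; simp
  have h2 := card_greedy_lt v le_rfl
  rw [h, Set.image_univ] at h2
  simpa using h2

/-- Near a spanning sequence, the determinant of a positive operator is controlled by the values
of its form on the greedily selected vectors. -/
lemma exists_det_le_prod_greedy {N : ℕ} (v₀ : Fin N → G)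
    (hv : Submodule.span ℝ (Set.range v₀) = ⊤) :
    ∃ C, 0 < C ∧ ∀ᶠ v in nhds v₀, ∀ A : G →ₗ[ℝ] G, PosDef A →
      LinearMap.det A ≤ C * ∏ n ∈ greedy v₀, ⟪A (v n), v n⟫ := by
  classical
  have hcard : Fintype.card (greedy v₀) = Module.finrank ℝ G := by
    rw [Fintype.card_coe, card_greedy, hv, finrank_top]
  let f : OrthonormalBasis (greedy v₀) ℝ G :=
    (stdOrthonormalBasis ℝ G).reindex (Fintype.equivOfCardEq (by simp [hcard]))
  let Δ : (Fin N → G) → ℝ := fun v =>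
    (f.toBasis.toMatrix fun n : greedy v₀ => v n).det
  have hΔ : Continuous Δ := by
    refine Continuous.matrix_det (continuous_matrix fun p n => ?_)
    simp only [Module.Basis.toMatrix_apply, OrthonormalBasis.coe_toBasis_repr_apply,
      OrthonormalBasis.repr_apply_apply]
    fun_prop
  have hne : Δ v₀ ≠ 0 := by
    let b : Module.Basis (greedy v₀) ℝ G := basisOfTopLeSpanOfCardEqFinrank
      (fun n : greedy v₀ => v₀ n) (by
        rw [← hv, ← span_greedy, Set.image_eq_range]
        rfl) hcard
    have hb : (fun n : greedy v₀ => v₀ n) = b := by simp [b]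
    have hu := f.toBasis.isUnit_det b
    simp only [Δ, hb]
    exact hu.ne_zero
  have hpos : 0 < Δ v₀ ^ 2 := by positivity
  refine ⟨(greedy v₀).card.factorial / (Δ v₀ ^ 2 / 2), by positivity, ?_⟩
  have hev : ∀ᶠ v in nhds v₀, Δ v₀ ^ 2 / 2 < Δ v ^ 2 :=
    (hΔ.pow 2).continuousAt.eventually_const_lt (by simp only [Pi.pow_apply]; linarith)
  filter_upwards [hev] with v hv A hA
  have h := hA.posSemidef.det_mul_sq_le f fun n : greedy v₀ => v n
  rw [Fintype.card_coe, Finset.prod_coe_sort (greedy v₀) fun n => ⟪A (v n), v n⟫] at h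
  rw [div_mul_eq_mul_div, le_div_iff₀ (by positivity)]
  refine le_trans ?_ h
  exact mul_le_mul_of_nonneg_left hv.le hA.det_pos.le

end Greedy

end FRBL

namespace FRBL

variable {k m : ℕ}
  {E : Fin k → Type*} {F : Fin m → Type*}
  [∀ i, NormedAddCommGroup (E i)] [∀ i, InnerProductSpace ℝ (E i)]
  [∀ j, NormedAddCommGroup (F j)] [∀ j, InnerProductSpace ℝ (F j)]
  {c : Fin k → ℝ} {d : Fin m → ℝ} {B : ∀ i j, E i →ₗ[ℝ] F j}

section ProductSubspaces

lemma projL_singleL_self (i : Fin k) (v : E i) : projL E i (singleL E i v) = v := by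
  simp [projL, singleL]

lemma projL_singleL_of_ne {i i' : Fin k} (h : i' ≠ i) (v : E i) :
    projL E i' (singleL E i v) = 0 := by
  simp [projL, singleL, h]

lemma Bop_apply (j : Fin m) (x : PiLp 2 E) : Bop E F B j x = ∑ i, B i j (projL E i x) := by
  simp [Bop]

lemma Bop_singleL (i : Fin k) (j : Fin m) (v : E i) :
    Bop E F B j (singleL E i v) = B i j v := by
  rw [Bop_apply, Finset.sum_eq_single i]
  · rw [projL_singleL_self]
  · intro i' _ h
    rw [projL_singleL_of_ne h, map_zero]
  · simp

/-- The product-form subspace with prescribed components. -/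
def prodSub (S : ∀ i, Submodule ℝ (E i)) : Submodule ℝ (PiLp 2 E) :=
  ⨅ i, (S i).comap (projL E i)

lemma mem_prodSub {S : ∀ i, Submodule ℝ (E i)} {x : PiLp 2 E} :
    x ∈ prodSub S ↔ ∀ i, projL E i x ∈ S i := by
  simp [prodSub, Submodule.mem_iInf]

lemma singleL_mem_prodSub {S : ∀ i, Submodule ℝ (E i)} {i : Fin k} {v : E i} (hv : v ∈ S i) :
    singleL E i v ∈ prodSub S := by
  rw [mem_prodSub]
  intro i'
  by_cases h : i' = i
  · subst h
    rwa [projL_singleL_self]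
  · rw [projL_singleL_of_ne h]
    exact zero_mem _

lemma productForm_prodSub (S : ∀ i, Submodule ℝ (E i)) : ProductForm E (prodSub S) :=
  fun _ hx i => singleL_mem_prodSub (mem_prodSub.1 hx i)

lemma map_projL_prodSub (S : ∀ i, Submodule ℝ (E i)) (i : Fin k) :
    (prodSub S).map (projL E i) = S i := by
  refine le_antisymm (Submodule.map_le_iff_le_comap.2 fun x hx => mem_prodSub.1 hx i) fun v hv => ?_
  exact ⟨singleL E i v, singleL_mem_prodSub hv, projL_singleL_self i v⟩

lemma map_Bop_prodSub (S : ∀ i, Submodule ℝ (E i)) (j : Fin m) :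
    (prodSub S).map (Bop E F B j) = ⨆ i, (S i).map (B i j) := by
  refine le_antisymm (Submodule.map_le_iff_le_comap.2 fun x hx => ?_) (iSup_le fun i => ?_)
  · rw [Submodule.mem_comap, Bop_apply]
    exact Submodule.sum_mem _ fun i _ =>
      Submodule.mem_iSup_of_mem i (Submodule.mem_map_of_mem (mem_prodSub.1 hx i))
  · rintro _ ⟨v, hv, rfl⟩
    exact ⟨singleL E i v, singleL_mem_prodSub hv, Bop_singleL i j v⟩

/-- The dimension condition holds with a uniform gap `δ` on nontrivial product subspaces. -/
def DimGap (c : Fin k → ℝ) (d : Fin m → ℝ) (B : ∀ i j, E i →ₗ[ℝ] F j) (δ : ℝ) : Prop :=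
  ∀ S : ∀ i, Submodule ℝ (E i), (∃ i, S i ≠ ⊥) → (∃ i, S i ≠ ⊤) →
    δ + ∑ i, c i * (Module.finrank ℝ (S i) : ℝ) ≤
      ∑ j, d j * (Module.finrank ℝ (⨆ i, (S i).map (B i j) : Submodule ℝ (F j)) : ℝ)

lemma DimCond.sum_finrank_le (h : DimCond E F c d B) (S : ∀ i, Submodule ℝ (E i)) :
    ∑ i, c i * (Module.finrank ℝ (S i) : ℝ) ≤
      ∑ j, d j * (Module.finrank ℝ (⨆ i, (S i).map (B i j) : Submodule ℝ (F j)) : ℝ) := by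
  have := h (prodSub S) (productForm_prodSub S)
  calc _ = ∑ i, c i * (Module.finrank ℝ ((prodSub S).map (projL E i)) : ℝ) :=
        Finset.sum_congr rfl fun i _ => by rw [map_projL_prodSub]
    _ ≤ _ := this
    _ = _ := Finset.sum_congr rfl fun j _ => by rw [map_Bop_prodSub]

lemma DimCond.dimGap_zero (h : DimCond E F c d B) : DimGap c d B 0 := fun S _ _ => by
  simpa using h.sum_finrank_le S

variable [∀ j, FiniteDimensional ℝ (F j)]

lemma DimCond.iSup_range_eq_top (h : DimCond E F c d B) (hsc : ScalingCond E F c d)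
    (hd : ∀ j, 0 < d j) (j : Fin m) : ⨆ i, LinearMap.range (B i j) = ⊤ := by
  have h1 := h.sum_finrank_le fun _ => ⊤
  simp only [finrank_top] at h1
  rw [ScalingCond] at hsc
  rw [hsc] at h1
  replace h1 : ∑ j, d j * (Module.finrank ℝ (F j) : ℝ) ≤
      ∑ j, d j * (Module.finrank ℝ (⨆ i, LinearMap.range (B i j) : Submodule ℝ (F j)) : ℝ) :=
    h1.trans_eq (Finset.sum_congr rfl fun j _ => by
      rw [iSup_congr fun i => Submodule.map_top (B i j)])
  apply Submodule.eq_top_of_finrank_eq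
  have hle : ∀ j ∈ Finset.univ,
      d j * (Module.finrank ℝ (⨆ i, LinearMap.range (B i j) : Submodule ℝ (F j)) : ℝ) ≤
        d j * (Module.finrank ℝ (F j) : ℝ) := fun j _ =>
    mul_le_mul_of_nonneg_left (by exact_mod_cast Submodule.finrank_le _) (hd j).le
  have h2 := (Finset.sum_eq_sum_iff_of_le hle).1 (le_antisymm (Finset.sum_le_sum hle) h1) j
    (Finset.mem_univ j)
  exact_mod_cast mul_left_cancel₀ (hd j).ne' h2

lemma DimCond.surjective (h : DimCond E F c d B) (hsc : ScalingCond E F c d)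
    (hd : ∀ j, 0 < d j) (j : Fin m) : Function.Surjective (Bop E F B j) := by
  rw [← LinearMap.range_eq_top, ← top_le_iff, ← h.iSup_range_eq_top hsc hd j, iSup_le_iff]
  rintro i _ ⟨v, rfl⟩
  exact ⟨singleL E i v, Bop_singleL i j v⟩

variable [∀ i, FiniteDimensional ℝ (E i)]

lemma DimCond.exists_dimGap (h : DimCond E F c d B) (hs : Simple E F c d B) :
    ∃ δ, 0 < δ ∧ DimGap c d B δ := by
  obtain ⟨δ, hδ, hgap⟩ := exists_pos_gap
    (fun p : (∀ i, Fin (Module.finrank ℝ (E i) + 1)) × (∀ j, Fin (Module.finrank ℝ (F j) + 1)) =>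
      ∑ j, d j * ((p.2 j : ℕ) : ℝ) - ∑ i, c i * ((p.1 i : ℕ) : ℝ))
  refine ⟨δ, hδ, fun S hbot htop => ?_⟩
  have hle := h.sum_finrank_le S
  have hne : ∑ i, c i * (Module.finrank ℝ (S i) : ℝ) ≠
      ∑ j, d j * (Module.finrank ℝ (⨆ i, (S i).map (B i j) : Submodule ℝ (F j)) : ℝ) := by
    intro heq
    refine hs (prodSub S) ⟨?_, ?_, productForm_prodSub S, ?_⟩
    · obtain ⟨i, hi⟩ := hbot
      intro h0
      apply hi
      rw [← map_projL_prodSub S i, h0, Submodule.map_bot]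
    · obtain ⟨i, hi⟩ := htop
      intro h0
      apply hi
      rw [← map_projL_prodSub S i, h0, Submodule.map_top, LinearMap.range_eq_top]
      exact fun v => ⟨singleL E i v, projL_singleL_self i v⟩
    · calc _ = ∑ i, c i * (Module.finrank ℝ (S i) : ℝ) :=
            Finset.sum_congr rfl fun i _ => by rw [map_projL_prodSub]
        _ = _ := heq
        _ = _ := Finset.sum_congr rfl fun j _ => by rw [map_Bop_prodSub]
  have hlt := lt_of_le_of_ne hle hne
  have := hgap (fun i => ⟨Module.finrank ℝ (S i), Nat.lt_succ_of_le (Submodule.finrank_le _)⟩,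
    fun j => ⟨Module.finrank ℝ (⨆ i, (S i).map (B i j) : Submodule ℝ (F j)),
      Nat.lt_succ_of_le (Submodule.finrank_le _)⟩) (by simpa using hlt)
  simp only at this
  linarith

end ProductSubspaces

section Frames

/-- Images under `B` of a family of vectors, enumerated along `σ`. -/
def frameImage {N : ℕ} (B : ∀ i j, E i →ₗ[ℝ] F j)
    (σ : Fin N ≃ Σ i, Fin (Module.finrank ℝ (E i)))
    (e : ∀ i, Fin (Module.finrank ℝ (E i)) → E i) (j : Fin m) (n : Fin N) : F j :=
  B (σ n).1 j (e (σ n).1 (σ n).2)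

open Classical in
/-- The span of the members of a frame whose positions lie in `A`. -/
def frameSpan {N : ℕ} (σ : Fin N ≃ Σ i, Fin (Module.finrank ℝ (E i)))
    (e : ∀ i, Fin (Module.finrank ℝ (E i)) → E i) (A : Set (Fin N)) (i : Fin k) :
    Submodule ℝ (E i) :=
  Submodule.span ℝ (e i '' {l | σ.symm ⟨i, l⟩ ∈ A})

variable {N : ℕ} (σ : Fin N ≃ Σ i, Fin (Module.finrank ℝ (E i)))
  (e : ∀ i, Fin (Module.finrank ℝ (E i)) → E i)

lemma iSup_map_frameSpan (A : Set (Fin N)) (j : Fin m) :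
    ⨆ i, (frameSpan σ e A i).map (B i j) = Submodule.span ℝ (frameImage B σ e j '' A) := by
  refine le_antisymm (iSup_le fun i => ?_) (Submodule.span_le.2 ?_)
  · rw [frameSpan, Submodule.map_span, Submodule.span_le]
    rintro _ ⟨_, ⟨l, hl, rfl⟩, rfl⟩
    refine Submodule.subset_span ⟨σ.symm ⟨i, l⟩, hl, ?_⟩
    rw [frameImage, Equiv.apply_symm_apply]
  · rintro _ ⟨n, hn, rfl⟩
    refine Submodule.mem_iSup_of_mem (σ n).1 (Submodule.mem_map_of_mem ?_)
    exact Submodule.subset_span ⟨(σ n).2, by simpa using hn, rfl⟩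

open Classical in
lemma finrank_frameSpan (he : ∀ i, Orthonormal ℝ (e i)) (A : Set (Fin N)) (i : Fin k) :
    Module.finrank ℝ (frameSpan σ e A i) =
      (Finset.univ.filter fun l => σ.symm ⟨i, l⟩ ∈ A).card := by
  have hset : {l | σ.symm ⟨i, l⟩ ∈ A} =
      ((Finset.univ.filter fun l => σ.symm ⟨i, l⟩ ∈ A : Finset _) : Set _) := by
    ext; simp
  have hli := (he i).linearIndependent.comp
    (Subtype.val : (Finset.univ.filter fun l => σ.symm ⟨i, l⟩ ∈ A : Finset _) → _)
    Subtype.val_injective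
  have h := finrank_span_eq_card hli
  rw [Set.range_comp, Subtype.range_coe_subtype, Fintype.card_coe] at h
  rw [frameSpan, hset, ← h]
  rfl

open Classical in
lemma sum_mul_finrank_frameSpan (he : ∀ i, Orthonormal ℝ (e i)) (A : Set (Fin N)) :
    ∑ i, c i * (Module.finrank ℝ (frameSpan σ e A i) : ℝ) =
      ∑ n with n ∈ A, c (σ n).1 := by
  simp only [finrank_frameSpan σ e he, Finset.card_filter]
  push_cast
  simp only [Finset.mul_sum, Finset.sum_filter]
  rw [← Fintype.sum_sigma (fun p : Σ i, Fin (Module.finrank ℝ (E i)) =>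
    c p.1 * if σ.symm p ∈ A then (1 : ℝ) else 0), ← Equiv.sum_comp σ]
  simp

lemma span_frame [∀ i, FiniteDimensional ℝ (E i)]
    (he : ∀ i, Orthonormal ℝ (e i)) (i : Fin k) :
    Submodule.span ℝ (Set.range (e i)) = ⊤ :=
  (he i).linearIndependent.span_eq_top_of_card_eq_finrank' (by simp)

lemma span_frameImage [∀ i, FiniteDimensional ℝ (E i)]
    (he : ∀ i, Orthonormal ℝ (e i)) {j : Fin m}
    (hB : ⨆ i, LinearMap.range (B i j) = ⊤) :
    Submodule.span ℝ (Set.range (frameImage B σ e j)) = ⊤ := by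
  rw [← Set.image_univ, ← iSup_map_frameSpan, ← hB]
  congr 1
  ext1 i
  have : {l | σ.symm ⟨i, l⟩ ∈ (Set.univ : Set (Fin N))} = Set.univ := by ext; simp
  rw [frameSpan, this, Set.image_univ, span_frame e he, Submodule.map_top]

open Classical in
/-- The weights attached to the positions of a frame. -/
def weight (c : Fin k → ℝ) (d : Fin m → ℝ) (B : ∀ i j, E i →ₗ[ℝ] F j) (n : Fin N) : ℝ :=
  ∑ j, (if n ∈ greedy (frameImage B σ e j) then d j else 0) - c (σ n).1

variable [∀ j, FiniteDimensional ℝ (F j)]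

lemma sum_weight_lt (he : ∀ i, Orthonormal ℝ (e i)) {r : ℕ} (hr : r ≤ N) :
    ∑ n with n.val < r, weight σ e c d B n =
      ∑ j, d j * (Module.finrank ℝ
          (⨆ i, (frameSpan σ e {n | n.val < r} i).map (B i j) : Submodule ℝ (F j)) : ℝ) -
        ∑ i, c i * (Module.finrank ℝ (frameSpan σ e {n | n.val < r} i) : ℝ) := by
  classical
  rw [sum_mul_finrank_frameSpan σ e he]
  have h : ∀ j, Module.finrank ℝ
      (⨆ i, (frameSpan σ e {n | n.val < r} i).map (B i j) : Submodule ℝ (F j)) =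
      ((greedy (frameImage B σ e j)).filter fun n => n.val < r).card := fun j => by
    rw [iSup_map_frameSpan, card_greedy_lt _ hr]
  simp only [weight, Finset.sum_sub_distrib, h]
  rw [Finset.sum_comm]
  congr 1
  · refine Finset.sum_congr rfl fun j _ => ?_
    rw [← Finset.sum_filter, Finset.sum_const, nsmul_eq_mul, mul_comm]
    congr 3
    ext n
    simp [and_comm]
  · simp

lemma le_sum_weight_lt (he : ∀ i, Orthonormal ℝ (e i)) {δ : ℝ} (hgap : DimGap c d B δ) {r : ℕ}
    (h0 : 0 < r) (hr : r < N) : δ ≤ ∑ n with n.val < r, weight σ e c d B n := by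
  rw [sum_weight_lt σ e he hr.le, le_sub_iff_add_le]
  refine hgap _ ⟨(σ ⟨0, h0.trans hr⟩).1, ?_⟩ ⟨(σ ⟨r, hr⟩).1, ?_⟩
  · intro h
    have : e _ (σ ⟨0, h0.trans hr⟩).2 ∈ frameSpan σ e {n | n.val < r} (σ ⟨0, h0.trans hr⟩).1 :=
      Submodule.subset_span ⟨_, by simpa using h0, rfl⟩
    rw [h, Submodule.mem_bot] at this
    exact (he _).ne_zero _ this
  · intro h
    have hmem : e _ (σ ⟨r, hr⟩).2 ∈ frameSpan σ e {n | n.val < r} (σ ⟨r, hr⟩).1 :=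
      h ▸ Submodule.mem_top
    exact (he _).linearIndependent.notMem_span_image (by simp) hmem

lemma sum_weight [∀ i, FiniteDimensional ℝ (E i)]
    (he : ∀ i, Orthonormal ℝ (e i)) (hsc : ScalingCond E F c d)
    (hB : ∀ j, ⨆ i, LinearMap.range (B i j) = ⊤) :
    ∑ n, weight σ e c d B n = 0 := by
  have h1 := sum_weight_lt (c := c) (d := d) (B := B) σ e he le_rfl
  have hN : {n : Fin N | n.val < N} = Set.univ := by ext; simp
  have h2 : ∀ i, frameSpan σ e {n | n.val < N} i = ⊤ := fun i => by
    have : {l | σ.symm ⟨i, l⟩ ∈ (Set.univ : Set (Fin N))} = Set.univ := by ext; simp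
    rw [hN, frameSpan, this, Set.image_univ, span_frame e he]
  have h3 : ∀ j, Module.finrank ℝ
      (⨆ i, (frameSpan σ e {n | n.val < N} i).map (B i j) : Submodule ℝ (F j)) =
      Module.finrank ℝ (F j) := fun j => by
    have h5 : ⨆ i, (frameSpan σ e {n | n.val < N} i).map (B i j) = ⊤ := by
      rw [← hB j]
      exact iSup_congr fun i => by rw [h2, Submodule.map_top]
    rw [h5, finrank_top]
  have h4 : ∀ i, Module.finrank ℝ (frameSpan σ e {n | n.val < N} i) =
      Module.finrank ℝ (E i) := fun i => by rw [h2, finrank_top]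
  simp only [h3, h4] at h1
  rw [ScalingCond] at hsc
  rw [hsc, sub_self] at h1
  simpa using h1

end Frames

end FRBL

namespace FRBL

section FrameBound

variable {k m : ℕ}
  {E : Fin k → Type*} {F : Fin m → Type*}
  [∀ i, NormedAddCommGroup (E i)] [∀ i, InnerProductSpace ℝ (E i)]
  [∀ j, NormedAddCommGroup (F j)] [∀ j, InnerProductSpace ℝ (F j)]
  {c : Fin k → ℝ} {d : Fin m → ℝ} {B : ∀ i j, E i →ₗ[ℝ] F j}
  {V : ∀ i, E i →ₗ[ℝ] E i} {U : ∀ j, F j →ₗ[ℝ] F j}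

lemma GaussCon.inner_le (h : GaussCon E F c d B V U) (hc : ∀ i, 0 < c i) (hd : ∀ j, 0 < d j)
    (hU : ∀ j, PosSemidef (U j)) (i : Fin k) (j : Fin m) (x : E i) :
    ⟪U j (B i j x), B i j x⟫ ≤ (d j * c i)⁻¹ * ⟪V i x, x⟫ := by
  classical
  have h1 := h (Pi.single i x)
  have h2 : ∀ j, ∑ i', c i' • B i' j (Pi.single i x i') = c i • B i j x := fun j => by
    rw [Finset.sum_eq_single i]
    · simp
    · intro i' _ hi
      simp [Pi.single_eq_of_ne hi]
    · simp
  have h3 : ∑ i', c i' * ⟪V i' (Pi.single i x i'), Pi.single i x i'⟫ = c i * ⟪V i x, x⟫ := by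
    rw [Finset.sum_eq_single i]
    · simp
    · intro i' _ hi
      simp [Pi.single_eq_of_ne hi]
    · simp
  simp only [h2] at h1
  rw [h3] at h1
  have h4 : d j * ⟪U j (c i • B i j x), c i • B i j x⟫ ≤ c i * ⟪V i x, x⟫ :=
    (Finset.single_le_sum (f := fun j => d j * ⟪U j (c i • B i j x), c i • B i j x⟫)
      (fun j _ => mul_nonneg (hd j).le ((hU j).2 _)) (Finset.mem_univ j)).trans h1
  simp only [map_smul, inner_smul_left, inner_smul_right, RCLike.conj_to_real] at h4
  have hci := hc i
  have hdj := hd j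
  rw [inv_mul_eq_div, le_div_iff₀ (by positivity)]
  nlinarith

/-- The objective is bounded by `C` on feasible pairs whose first component is diagonal in the
frame `e`, with a gain proportional to the spread of the logarithms of the eigenvalues. -/
def FrameBound (c : Fin k → ℝ) (d : Fin m → ℝ) (B : ∀ i j, E i →ₗ[ℝ] F j) (δ C : ℝ)
    (e : ∀ i, Fin (Module.finrank ℝ (E i)) → E i)
    (P : (∀ i, Fin (Module.finrank ℝ (E i)) → ℝ) → Prop) : Prop :=
  ∀ (V : ∀ i, E i →ₗ[ℝ] E i) (U : ∀ j, F j →ₗ[ℝ] F j)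
    (ν : ∀ i, Fin (Module.finrank ℝ (E i)) → ℝ),
    (∀ i, PosDef (V i)) → (∀ j, PosDef (U j)) → GaussCon E F c d B V U →
    (∀ i l, V i (e i l) = ν i l • e i l) → P ν →
    objective E F c d V U ≤ C ∧
      ∀ p q : Σ i, Fin (Module.finrank ℝ (E i)),
        objective E F c d V U ≤ C - δ * (Real.log (ν p.1 p.2) - Real.log (ν q.1 q.2))

lemma FrameBound.mono {δ C C' : ℝ} {e : ∀ i, Fin (Module.finrank ℝ (E i)) → E i}
    {P : (∀ i, Fin (Module.finrank ℝ (E i)) → ℝ) → Prop} (h : FrameBound c d B δ C e P)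
    (hC : C ≤ C') : FrameBound c d B δ C' e P := fun V U ν hV hU hVU hν hP => by
  obtain ⟨h1, h2⟩ := h V U ν hV hU hVU hν hP
  exact ⟨h1.trans hC, fun p q => (h2 p q).trans (sub_le_sub_right hC _)⟩

variable [∀ i, FiniteDimensional ℝ (E i)] [∀ j, FiniteDimensional ℝ (F j)]

lemma exists_frameBound_of_monotone (hc : ∀ i, 0 < c i) (hd : ∀ j, 0 < d j)
    (hsc : ScalingCond E F c d) (hdim : DimCond E F c d B) {δ : ℝ} (hδ : 0 ≤ δ)
    (hgap : DimGap c d B δ) {N : ℕ} (σ : Fin N ≃ Σ i, Fin (Module.finrank ℝ (E i)))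
    (e₀ : ∀ i, Fin (Module.finrank ℝ (E i)) → E i) (he₀ : ∀ i, Orthonormal ℝ (e₀ i)) :
    ∃ C, ∀ᶠ e in nhds e₀, (∀ i, Orthonormal ℝ (e i)) →
      FrameBound c d B δ C e fun ν => Monotone fun n => ν (σ n).1 (σ n).2 := by
  classical
  have hB := hdim.iSup_range_eq_top hsc hd
  choose K hK hKe using fun j =>
    exists_det_le_prod_greedy (frameImage B σ e₀ j) (span_frameImage σ e₀ he₀ (hB j))
  have hcont : ∀ j, Continuous fun e => frameImage B σ e j := fun j => by
    refine continuous_pi fun n => ?_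
    exact (B (σ n).1 j).continuous_of_finiteDimensional.comp (by fun_prop)
  have hev : ∀ᶠ e in nhds e₀, ∀ j, ∀ A : F j →ₗ[ℝ] F j, PosDef A →
      LinearMap.det A ≤ K j * ∏ n ∈ greedy (frameImage B σ e₀ j),
        ⟪A (frameImage B σ e j n), frameImage B σ e j n⟫ :=
    Filter.eventually_all.2 fun j => (hcont j).continuousAt.eventually (hKe j)
  refine ⟨∑ j, d j * (Real.log (K j) + ∑ n ∈ greedy (frameImage B σ e₀ j),
    Real.log ((d j * c (σ n).1)⁻¹)), hev.mono fun e hdet he V U ν hV hU hVU hν hmono => ?_⟩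
  have hνpos : ∀ i l, 0 < ν i l := fun i l => by
    have := (hV i).2 _ ((he i).ne_zero l)
    rw [hν, inner_smul_left, real_inner_self_eq_norm_sq, (he i).1 l] at this
    simpa using this
  have hdetV : ∀ i, Real.log (LinearMap.det (V i)) = ∑ l, Real.log (ν i l) := fun i => by
    rw [det_eq_prod_of_eigen (OrthonormalBasis.mk (he i) (span_frame e he i).ge) (ν i)
      (by simpa using hν i), Real.log_prod fun l _ => (hνpos i l).ne']
  have hdetU : ∀ j, Real.log (LinearMap.det (U j)) ≤ Real.log (K j) +
      ∑ n ∈ greedy (frameImage B σ e₀ j),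
        (Real.log ((d j * c (σ n).1)⁻¹) + Real.log (ν (σ n).1 (σ n).2)) := fun j => by
    have hpos : ∀ n, 0 < (d j * c (σ n).1)⁻¹ * ν (σ n).1 (σ n).2 := fun n =>
      mul_pos (inv_pos.2 (mul_pos (hd j) (hc _))) (hνpos _ _)
    have h1 : LinearMap.det (U j) ≤ K j * ∏ n ∈ greedy (frameImage B σ e₀ j),
        ((d j * c (σ n).1)⁻¹ * ν (σ n).1 (σ n).2) := by
      refine (hdet j (U j) (hU j)).trans (mul_le_mul_of_nonneg_left ?_ (hK j).le)
      refine Finset.prod_le_prod (fun n _ => (hU j).posSemidef.2 _) fun n _ => ?_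
      refine (hVU.inner_le hc hd (fun j => (hU j).posSemidef) _ j _).trans_eq ?_
      rw [hν, inner_smul_left, real_inner_self_eq_norm_sq, (he _).1]
      simp
    refine (Real.log_le_log (hU j).det_pos h1).trans_eq ?_
    rw [Real.log_mul (hK j).ne' (Finset.prod_pos fun n _ => hpos n).ne',
      Real.log_prod fun n _ => (hpos n).ne']
    congr 1
    exact Finset.sum_congr rfl fun n _ =>
      Real.log_mul (inv_pos.2 (mul_pos (hd j) (hc _))).ne' (hνpos _ _).ne'
  have hobj : objective E F c d V U ≤ ∑ j, d j * (Real.log (K j) +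
      ∑ n ∈ greedy (frameImage B σ e₀ j), Real.log ((d j * c (σ n).1)⁻¹)) +
      ∑ n, weight σ e₀ c d B n * Real.log (ν (σ n).1 (σ n).2) := by
    have h1 : ∑ i, c i * Real.log (LinearMap.det (V i)) =
        ∑ n, c (σ n).1 * Real.log (ν (σ n).1 (σ n).2) := by
      rw [Equiv.sum_comp σ fun p => c p.1 * Real.log (ν p.1 p.2), Fintype.sum_sigma]
      simp only [hdetV, Finset.mul_sum]
    have h2 : ∑ n, weight σ e₀ c d B n * Real.log (ν (σ n).1 (σ n).2) =
        ∑ j, d j * ∑ n ∈ greedy (frameImage B σ e₀ j), Real.log (ν (σ n).1 (σ n).2) -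
          ∑ n, c (σ n).1 * Real.log (ν (σ n).1 (σ n).2) := by
      simp only [weight, sub_mul, Finset.sum_sub_distrib, Finset.sum_mul, ite_mul, zero_mul,
        Finset.mul_sum]
      rw [Finset.sum_comm]
      simp
    rw [objective, h1, h2, ← add_sub_assoc, ← Finset.sum_add_distrib]
    refine sub_le_sub_right (Finset.sum_le_sum fun j _ => ?_) _
    rw [← mul_add, add_assoc, ← Finset.sum_add_distrib]
    exact mul_le_mul_of_nonneg_left (hdetU j) (hd j).le
  have hlog : Monotone fun n => Real.log (ν (σ n).1 (σ n).2) := fun a b hab =>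
    Real.log_le_log (hνpos _ _) (hmono hab)
  obtain ⟨h1, h2⟩ := sum_fin_mul_le_of_partial_sums _ _ hlog hδ
    (fun r h0 hr => le_sum_weight_lt σ e₀ he₀ hgap h0 hr) (sum_weight σ e₀ he₀ hsc hB)
  refine ⟨by linarith, fun p q => ?_⟩
  obtain ⟨a, rfl⟩ := σ.surjective p
  obtain ⟨b, rfl⟩ := σ.surjective q
  linarith [h2 a b]

lemma exists_eventually_frameBound (hc : ∀ i, 0 < c i) (hd : ∀ j, 0 < d j)
    (hsc : ScalingCond E F c d) (hdim : DimCond E F c d B) {δ : ℝ} (hδ : 0 ≤ δ)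
    (hgap : DimGap c d B δ)
    (e₀ : ∀ i, Fin (Module.finrank ℝ (E i)) → E i) (he₀ : ∀ i, Orthonormal ℝ (e₀ i)) :
    ∃ C, ∀ᶠ e in nhds e₀, (∀ i, Orthonormal ℝ (e i)) →
      FrameBound c d B δ C e fun _ => True := by
  classical
  choose C hC using fun σ : Fin (Fintype.card (Σ i, Fin (Module.finrank ℝ (E i)))) ≃
    Σ i, Fin (Module.finrank ℝ (E i)) =>
      exists_frameBound_of_monotone hc hd hsc hdim hδ hgap σ e₀ he₀
  refine ⟨∑ σ, |C σ|, (Filter.eventually_all.2 hC).mono fun e he hon V U ν hV hU hVU hν _ => ?_⟩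
  let σ₀ := (Fintype.equivFin (Σ i, Fin (Module.finrank ℝ (E i)))).symm
  let τ := Tuple.sort fun n => ν (σ₀ n).1 (σ₀ n).2
  have hle : C (τ.trans σ₀) ≤ ∑ σ, |C σ| := (le_abs_self _).trans
    (Finset.single_le_sum (f := fun σ => |C σ|) (fun σ _ => abs_nonneg _) (Finset.mem_univ _))
  exact (he (τ.trans σ₀) hon).mono hle V U ν hV hU hVU hν
    (Tuple.monotone_sort fun n => ν (σ₀ n).1 (σ₀ n).2)

variable (E) in
lemma isCompact_frames : IsCompact
    {e : ∀ i, Fin (Module.finrank ℝ (E i)) → E i | ∀ i, Orthonormal ℝ (e i)} := by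
  have : ∀ i, ProperSpace (E i) := fun i => FiniteDimensional.proper ℝ (E i)
  refine Metric.isCompact_of_isClosed_isBounded ?_ ?_
  · classical
    simp only [orthonormal_iff_ite, Set.ofPred_forall]
    refine isClosed_iInter fun i => isClosed_iInter fun a => isClosed_iInter fun b => ?_
    exact isClosed_eq (by fun_prop) continuous_const
  · refine (Metric.isBounded_iff_subset_closedBall 0).2 ⟨1, fun e he => ?_⟩
    rw [mem_closedBall_zero_iff]
    exact (pi_norm_le_iff_of_nonneg zero_le_one).2 fun i =>
      (pi_norm_le_iff_of_nonneg zero_le_one).2 fun a => ((he i).1 a).le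

lemma exists_frameBound (hc : ∀ i, 0 < c i) (hd : ∀ j, 0 < d j)
    (hsc : ScalingCond E F c d) (hdim : DimCond E F c d B) {δ : ℝ} (hδ : 0 ≤ δ)
    (hgap : DimGap c d B δ) :
    ∃ C, ∀ e : ∀ i, Fin (Module.finrank ℝ (E i)) → E i, (∀ i, Orthonormal ℝ (e i)) →
      FrameBound c d B δ C e fun _ => True := by
  obtain ⟨C, hC⟩ := (isCompact_frames E).induction_on
    (p := fun s => ∃ C, ∀ e ∈ s, (∀ i, Orthonormal ℝ (e i)) →
      FrameBound c d B δ C e fun _ => True)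
    ⟨0, by simp⟩ (fun s t hst ⟨C, hC⟩ => ⟨C, fun e he => hC e (hst he)⟩)
    (fun s t ⟨C, hC⟩ ⟨C', hC'⟩ => ⟨max C C', fun e he hon => he.elim
      (fun h => (hC e h hon).mono (le_max_left _ _))
      fun h => (hC' e h hon).mono (le_max_right _ _)⟩)
    fun e₀ he₀ => by
      obtain ⟨C, hC⟩ := exists_eventually_frameBound hc hd hsc hdim hδ hgap e₀ he₀
      exact ⟨_, mem_nhdsWithin_of_mem_nhds hC, C, fun e he => he⟩
  exact ⟨C, fun e he => hC e he he⟩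

/-- Feasible pairs admit an eigenframe, in which the objective is controlled by the spread of the
eigenvalues. -/
lemma exists_objective_le (hc : ∀ i, 0 < c i) (hd : ∀ j, 0 < d j)
    (hsc : ScalingCond E F c d) (hdim : DimCond E F c d B) {δ : ℝ} (hδ : 0 ≤ δ)
    (hgap : DimGap c d B δ) :
    ∃ C, ∀ (V : ∀ i, E i →ₗ[ℝ] E i) (U : ∀ j, F j →ₗ[ℝ] F j),
      (∀ i, PosDef (V i)) → (∀ j, PosDef (U j)) → GaussCon E F c d B V U →
      objective E F c d V U ≤ C ∧
        ∃ (f : ∀ i, OrthonormalBasis (Fin (Module.finrank ℝ (E i))) ℝ (E i))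
          (ν : ∀ i, Fin (Module.finrank ℝ (E i)) → ℝ),
          (∀ i l, 0 < ν i l) ∧ (∀ i l, V i (f i l) = ν i l • f i l) ∧
          ∀ p q : Σ i, Fin (Module.finrank ℝ (E i)),
            objective E F c d V U ≤ C - δ * (Real.log (ν p.1 p.2) - Real.log (ν q.1 q.2)) := by
  obtain ⟨C, hC⟩ := exists_frameBound hc hd hsc hdim hδ hgap
  refine ⟨C, fun V U hV hU hVU => ?_⟩
  choose f ν hν hf using fun i => (hV i).exists_eigen
  obtain ⟨h1, h2⟩ := hC (fun i => f i) (fun i => (f i).orthonormal) V U ν hV hU hVU hf trivial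
  exact ⟨h1, f, ν, hν, hf, h2⟩

end FrameBound

end FRBL

namespace FRBL

section Necessity

variable {k m : ℕ}
  {E : Fin k → Type*} {F : Fin m → Type*}
  [∀ i, NormedAddCommGroup (E i)] [∀ i, InnerProductSpace ℝ (E i)]
  [∀ j, NormedAddCommGroup (F j)] [∀ j, InnerProductSpace ℝ (F j)]
  {c : Fin k → ℝ} {d : Fin m → ℝ} {B : ∀ i j, E i →ₗ[ℝ] F j}
  {V : ∀ i, E i →ₗ[ℝ] E i} {U : ∀ j, F j →ₗ[ℝ] F j}

lemma posDef_id {G : Type*} [NormedAddCommGroup G] [InnerProductSpace ℝ G] :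
    PosDef (LinearMap.id : G →ₗ[ℝ] G) :=
  ⟨fun _ _ => rfl, fun _ hx => real_inner_self_pos.2 hx⟩

lemma PosDef.log_det_smul {G : Type*} [NormedAddCommGroup G] [InnerProductSpace ℝ G]
    [FiniteDimensional ℝ G] {A : G →ₗ[ℝ] G} (hA : PosDef A) {t : ℝ} (ht : 0 < t) :
    Real.log (LinearMap.det (t • A)) =
      Module.finrank ℝ G * Real.log t + Real.log (LinearMap.det A) := by
  rw [LinearMap.det_smul, Real.log_mul (pow_pos ht _).ne' hA.det_pos.ne', Real.log_pow]

lemma GaussCon.smul (h : GaussCon E F c d B V U) {t : ℝ} (ht : 0 ≤ t) :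
    GaussCon E F c d B (fun i => t • V i) (fun j => t • U j) := fun x => by
  have h1 := mul_le_mul_of_nonneg_left (h x) ht
  simp only [LinearMap.smul_apply, inner_smul_left, RCLike.conj_to_real, mul_left_comm _ t,
    ← Finset.mul_sum]
  exact h1

lemma exists_objective_le_of_Dg_lt_top (h : Dg E F c d B < ⊤) :
    ∃ M, ∀ (V : ∀ i, E i →ₗ[ℝ] E i) (U : ∀ j, F j →ₗ[ℝ] F j), (∀ i, PosDef (V i)) →
      (∀ j, PosDef (U j)) → GaussCon E F c d B V U → objective E F c d V U ≤ M := by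
  obtain ⟨M, hM, -⟩ := EReal.lt_iff_exists_real_btwn.1 h
  refine ⟨2 * M, fun V U hV hU hVU => ?_⟩
  have h1 : ((gaussObj E F c d V U : ℝ) : EReal) ≤ Dg E F c d B :=
    le_sSup ⟨V, U, hV, hU, hVU, rfl⟩
  have h2 : objective E F c d V U / 2 ≤ M := EReal.coe_le_coe_iff.1 (h1.trans hM.le)
  linarith

variable [∀ i, FiniteDimensional ℝ (E i)]

variable (c d B) in
lemma exists_sum_norm_sq_le (hc : ∀ i, 0 < c i) (hd : ∀ j, 0 < d j) :
    ∃ C, 0 < C ∧ ∀ x : ∀ i, E i,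
      ∑ j, d j * ‖∑ i, c i • B i j (x i)‖ ^ 2 ≤ C * ∑ i, c i * ‖x i‖ ^ 2 := by
  have hb0 : ∀ i j, 0 ≤ ‖(B i j).toContinuousLinearMap‖ := fun i j => norm_nonneg _
  have hS : ∀ j, 0 ≤ d j * ∑ i, c i * ‖(B i j).toContinuousLinearMap‖ ^ 2 := fun j =>
    mul_nonneg (hd j).le (Finset.sum_nonneg fun i _ => mul_nonneg (hc i).le (by positivity))
  refine ⟨1 + ∑ j, d j * ∑ i, c i * ‖(B i j).toContinuousLinearMap‖ ^ 2,
    add_pos_of_pos_of_nonneg one_pos (Finset.sum_nonneg fun j _ => hS j), fun x => ?_⟩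
  have hx : 0 ≤ ∑ i, c i * ‖x i‖ ^ 2 :=
    Finset.sum_nonneg fun i _ => mul_nonneg (hc i).le (by positivity)
  rw [add_mul, one_mul, Finset.sum_mul]
  refine le_add_of_nonneg_of_le hx (Finset.sum_le_sum fun j _ => ?_)
  rw [mul_assoc]
  refine mul_le_mul_of_nonneg_left ?_ (hd j).le
  have h1 : ‖∑ i, c i • B i j (x i)‖ ≤
      ∑ i, c i * (‖(B i j).toContinuousLinearMap‖ * ‖x i‖) :=
    norm_sum_le_of_le _ fun i _ => by
      rw [norm_smul, Real.norm_of_nonneg (hc i).le]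
      exact mul_le_mul_of_nonneg_left ((B i j).toContinuousLinearMap.le_opNorm (x i)) (hc i).le
  refine (pow_le_pow_left₀ (norm_nonneg _) h1 2).trans ?_
  refine Finset.sum_sq_le_sum_mul_sum_of_sq_le_mul _
    (fun i _ => mul_nonneg (hc i).le (by positivity))
    (fun i _ => mul_nonneg (hc i).le (by positivity)) fun i _ => le_of_eq (by ring)

variable (c d B) in
lemma exists_feasible (hc : ∀ i, 0 < c i) (hd : ∀ j, 0 < d j) :
    ∃ (V : ∀ i, E i →ₗ[ℝ] E i) (U : ∀ j, F j →ₗ[ℝ] F j),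
      (∀ i, PosDef (V i)) ∧ (∀ j, PosDef (U j)) ∧ GaussCon E F c d B V U := by
  obtain ⟨C, hC, h⟩ := exists_sum_norm_sq_le c d B hc hd
  refine ⟨fun i => C • LinearMap.id, fun j => LinearMap.id, fun i => posDef_id.smul hC,
    fun j => posDef_id, fun x => ?_⟩
  simpa [inner_smul_left, mul_left_comm _ C, ← Finset.mul_sum, real_inner_self_eq_norm_sq]
    using h x

lemma bot_lt_Dg (hc : ∀ i, 0 < c i) (hd : ∀ j, 0 < d j) : ⊥ < Dg E F c d B := by
  obtain ⟨V, U, hV, hU, hVU⟩ := exists_feasible c d B hc hd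
  exact (EReal.bot_lt_coe _).trans_le (le_sSup ⟨V, U, hV, hU, hVU, rfl⟩)

variable [∀ j, FiniteDimensional ℝ (F j)]

lemma objective_smul (hV : ∀ i, PosDef (V i)) (hU : ∀ j, PosDef (U j)) {t : ℝ} (ht : 0 < t) :
    objective E F c d (fun i => t • V i) (fun j => t • U j) =
      objective E F c d V U + Real.log t * (∑ j, d j * (Module.finrank ℝ (F j) : ℝ) -
        ∑ i, c i * (Module.finrank ℝ (E i) : ℝ)) := by
  simp only [objective, (hU _).log_det_smul ht, (hV _).log_det_smul ht, mul_add,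
    Finset.sum_add_distrib, ← mul_assoc, ← Finset.sum_mul]
  ring

lemma scalingCond_of_objective_le (hc : ∀ i, 0 < c i) (hd : ∀ j, 0 < d j) {M : ℝ}
    (hM : ∀ (V : ∀ i, E i →ₗ[ℝ] E i) (U : ∀ j, F j →ₗ[ℝ] F j), (∀ i, PosDef (V i)) →
      (∀ j, PosDef (U j)) → GaussCon E F c d B V U → objective E F c d V U ≤ M) :
    ScalingCond E F c d := by
  obtain ⟨V, U, hV, hU, h⟩ := exists_feasible c d B hc hd
  set Δ := ∑ j, d j * (Module.finrank ℝ (F j) : ℝ) - ∑ i, c i * (Module.finrank ℝ (E i) : ℝ)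
    with hΔ
  have h1 : ∀ s : ℝ, s * Δ ≤ M - objective E F c d V U := fun s => by
    have := hM _ _ (fun i => (hV i).smul (Real.exp_pos s)) (fun j => (hU j).smul (Real.exp_pos s))
      (h.smul (Real.exp_pos s).le)
    rw [objective_smul hV hU (Real.exp_pos s), Real.log_exp] at this
    linarith
  have h2 : Δ = 0 := by
    by_contra hne
    have := h1 ((M - objective E F c d V U + 1) / Δ)
    rw [div_mul_cancel₀ _ hne] at this
    linarith
  rw [ScalingCond]
  linarith

lemma norm_stretch_le {G : Type*} [NormedAddCommGroup G] [InnerProductSpace ℝ G]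
    [FiniteDimensional ℝ G] (S : Submodule ℝ G) {ε : ℝ} (hε : 0 ≤ ε) (hε1 : ε ≤ 1) {a : G}
    (ha : a ∈ S) (b : G) :
    ⟪stretch S ε (a + b), a + b⟫ ≤ 2 * (ε * ‖a‖ ^ 2 + ‖b‖ ^ 2) := by
  have h1 := inner_stretch S 1 b
  rw [inner_stretch, map_add, S.starProjection_eq_self_iff.2 ha, add_sub_add_left_eq_sub]
  simp only [stretch, sub_self, zero_smul, add_zero, LinearMap.id_apply,
    real_inner_self_eq_norm_sq, one_mul] at h1
  have h2 : ‖a + S.starProjection b‖ ^ 2 ≤ 2 * (‖a‖ ^ 2 + ‖S.starProjection b‖ ^ 2) := by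
    have := parallelogram_law_with_norm ℝ a (S.starProjection b)
    nlinarith [norm_nonneg (a - S.starProjection b)]
  have h3 := mul_le_mul_of_nonneg_left h2 hε
  have h4 : ε * ‖S.starProjection b‖ ^ 2 ≤ 1 * ‖S.starProjection b‖ ^ 2 :=
    mul_le_mul_of_nonneg_right hε1 (by positivity)
  nlinarith [sq_nonneg ‖b - S.starProjection b‖]

lemma dimCond_of_objective_le (hc : ∀ i, 0 < c i) (hd : ∀ j, 0 < d j) {M : ℝ}
    (hM : ∀ (V : ∀ i, E i →ₗ[ℝ] E i) (U : ∀ j, F j →ₗ[ℝ] F j), (∀ i, PosDef (V i)) →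
      (∀ j, PosDef (U j)) → GaussCon E F c d B V U → objective E F c d V U ≤ M) :
    DimCond E F c d B := by
  intro T hT
  obtain ⟨C, hC, hbound⟩ := exists_sum_norm_sq_le c d B hc hd
  have hη : 0 < (2 * C)⁻¹ := by positivity
  have hmem : ∀ i j, ∀ v ∈ T.map (projL E i), B i j v ∈ T.map (Bop E F B j) := by
    rintro i j _ ⟨z, hz, rfl⟩
    exact ⟨_, hT z hz i, Bop_singleL i j _⟩
  have hfeas : ∀ ε : ℝ, 0 < ε → ε ≤ 1 →
      GaussCon E F c d B (fun i => stretch (T.map (projL E i)) ε)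
        (fun j => (2 * C)⁻¹ • stretch (T.map (Bop E F B j)) ε) := by
    intro ε hε hε1 x
    set t : ∀ i, E i := fun i => (T.map (projL E i)).starProjection (x i) with ht
    set s : ∀ i, E i := fun i => x i - t i with hs
    have hsplit : ∀ j, ∑ i, c i • B i j (x i) =
        ∑ i, c i • B i j (t i) + ∑ i, c i • B i j (s i) := fun j => by
      rw [← Finset.sum_add_distrib]
      refine Finset.sum_congr rfl fun i _ => ?_
      rw [← smul_add, ← map_add, hs, add_sub_cancel]
    have hta : ∀ j, ∑ i, c i • B i j (t i) ∈ T.map (Bop E F B j) := fun j =>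
      Submodule.sum_mem _ fun i _ => Submodule.smul_mem _ _
        (hmem i j _ (Submodule.starProjection_apply_mem _ _))
    calc _ ≤ ∑ j, d j * ((2 * C)⁻¹ * (2 * (ε * ‖∑ i, c i • B i j (t i)‖ ^ 2 +
            ‖∑ i, c i • B i j (s i)‖ ^ 2))) := by
          refine Finset.sum_le_sum fun j _ => mul_le_mul_of_nonneg_left ?_ (hd j).le
          rw [LinearMap.smul_apply, inner_smul_left, RCLike.conj_to_real, hsplit j]
          exact mul_le_mul_of_nonneg_left (norm_stretch_le _ hε.le hε1 (hta j) _) hη.le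
      _ = C⁻¹ * (ε * ∑ j, d j * ‖∑ i, c i • B i j (t i)‖ ^ 2 +
            ∑ j, d j * ‖∑ i, c i • B i j (s i)‖ ^ 2) := by
          rw [Finset.mul_sum, ← Finset.sum_add_distrib, Finset.mul_sum]
          refine Finset.sum_congr rfl fun j _ => ?_
          field_simp
      _ ≤ C⁻¹ * (ε * (C * ∑ i, c i * ‖t i‖ ^ 2) + C * ∑ i, c i * ‖s i‖ ^ 2) := by
          have h1 := mul_le_mul_of_nonneg_left (hbound t) hε.le
          exact mul_le_mul_of_nonneg_left (add_le_add h1 (hbound s)) (by positivity)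
      _ = ∑ i, c i * (ε * ‖t i‖ ^ 2 + ‖s i‖ ^ 2) := by
          simp only [mul_add, Finset.sum_add_distrib, mul_left_comm _ ε, ← Finset.mul_sum]
          field_simp
      _ = _ := Finset.sum_congr rfl fun i _ => by rw [inner_stretch]
  by_contra! hlt
  set Δ := ∑ j, d j * (Module.finrank ℝ (T.map (Bop E F B j)) : ℝ) -
    ∑ i, c i * (Module.finrank ℝ (T.map (projL E i)) : ℝ) with hΔ
  set L := ∑ j, d j * (Module.finrank ℝ (F j) * Real.log (2 * C)⁻¹) with hL
  have hΔneg : Δ < 0 := by linarith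
  have key : ∀ l : ℝ, l ≤ 0 → l * Δ ≤ M - L := fun l hl => by
    have hε := Real.exp_pos l
    have := hM _ _ (fun i => posDef_stretch (T.map (projL E i)) hε)
      (fun j => (posDef_stretch (T.map (Bop E F B j)) hε).smul hη)
      (hfeas _ hε (Real.exp_le_one_iff.2 hl))
    have h1 : ∀ j, Real.log (LinearMap.det ((2 * C)⁻¹ • stretch (T.map (Bop E F B j))
        (Real.exp l))) = Module.finrank ℝ (F j) * Real.log (2 * C)⁻¹ +
          Module.finrank ℝ (T.map (Bop E F B j)) * l := fun j => by
      rw [LinearMap.det_smul, det_stretch, Real.log_mul (pow_pos hη _).ne' (pow_pos hε _).ne',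
        Real.log_pow, Real.log_pow, Real.log_exp]
    simp only [objective, h1, det_stretch, Real.log_pow, Real.log_exp, mul_add,
      Finset.sum_add_distrib] at this
    rw [hΔ, mul_sub, Finset.mul_sum, Finset.mul_sum]
    simp only [mul_left_comm l, mul_comm l]
    linarith
  have h1 := key (-(|M - L| + 1) / -Δ) (by
    rw [neg_div_neg_eq]
    exact div_nonpos_of_nonneg_of_nonpos (by positivity) hΔneg.le)
  rw [neg_div_neg_eq, div_mul_cancel₀ _ hΔneg.ne] at h1
  linarith [le_abs_self (M - L)]

end Necessity

end FRBL

namespace FRBL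

section Extremizers

/-- Positive semidefinite operators with form at most `R` and determinant at least `a`. -/
def posBox (G : Type*) [NormedAddCommGroup G] [InnerProductSpace ℝ G] (R a : ℝ) :
    Set (G →L[ℝ] G) :=
  {A | PosSemidef (A : G →ₗ[ℝ] G) ∧ (∀ x, ⟪A x, x⟫ ≤ R * ‖x‖ ^ 2) ∧
    a ≤ LinearMap.det (A : G →ₗ[ℝ] G)}

lemma isCompact_posBox {G : Type*} [NormedAddCommGroup G] [InnerProductSpace ℝ G]
    [FiniteDimensional ℝ G] {R a : ℝ} (hR : 0 ≤ R) : IsCompact (posBox G R a) := by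
  have : ProperSpace (G →L[ℝ] G) := FiniteDimensional.proper ℝ _
  refine Metric.isCompact_of_isClosed_isBounded ?_ ?_
  · simp only [posBox, PosSemidef, LinearMap.IsSymmetric, ContinuousLinearMap.coe_coe]
    refine IsClosed.and (IsClosed.and ?_ ?_) (IsClosed.and ?_ ?_)
    · simp only [Set.ofPred_forall]
      exact isClosed_iInter fun x => isClosed_iInter fun y =>
        isClosed_eq (by fun_prop) (by fun_prop)
    · simp only [Set.ofPred_forall]
      exact isClosed_iInter fun x => isClosed_le (by fun_prop) (by fun_prop)
    · simp only [Set.ofPred_forall]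
      exact isClosed_iInter fun x => isClosed_le (by fun_prop) (by fun_prop)
    · exact isClosed_le continuous_const ContinuousLinearMap.continuous_det
  · refine (Metric.isBounded_iff_subset_closedBall 0).2 ⟨R, fun A hA => ?_⟩
    rw [mem_closedBall_zero_iff]
    exact A.opNorm_le_bound hR fun x => hA.1.norm_apply_le hA.2.1 hR x

variable {k m : ℕ}
  {E : Fin k → Type*} {F : Fin m → Type*}
  [∀ i, NormedAddCommGroup (E i)] [∀ i, InnerProductSpace ℝ (E i)]
  [∀ j, NormedAddCommGroup (F j)] [∀ j, InnerProductSpace ℝ (F j)]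
  [∀ j, FiniteDimensional ℝ (F j)]
  {c : Fin k → ℝ} {d : Fin m → ℝ} {B : ∀ i j, E i →ₗ[ℝ] F j}

lemma exists_inner_le (hc : ∀ i, 0 < c i) (hd : ∀ j, 0 < d j) {j : Fin m}
    (hB : Function.Surjective (Bop E F B j)) :
    ∃ R, 0 < R ∧ ∀ (V : ∀ i, E i →ₗ[ℝ] E i) (U : ∀ j, F j →ₗ[ℝ] F j),
      (∀ j, PosSemidef (U j)) → GaussCon E F c d B V U → (∀ i x, ⟪V i x, x⟫ ≤ ‖x‖ ^ 2) →
      ∀ y, ⟪U j y, y⟫ ≤ R * ‖y‖ ^ 2 := by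
  obtain ⟨g, hg⟩ := (Bop E F B j).exists_rightInverse_of_surjective
    (LinearMap.range_eq_top.2 hB)
  let G : ∀ i, F j →L[ℝ] E i := fun i =>
    ((c i)⁻¹ • (projL E i ∘ₗ g)).toContinuousLinearMap
  have hpos : 0 ≤ ∑ i, c i * ‖G i‖ ^ 2 :=
    Finset.sum_nonneg fun i _ => mul_nonneg (hc i).le (by positivity)
  have hdj := hd j
  refine ⟨(d j)⁻¹ * (1 + ∑ i, c i * ‖G i‖ ^ 2), by positivity, fun V U hU hVU hV y => ?_⟩
  have hy : ∑ i, c i • B i j (G i y) = y := by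
    have h1 : Bop E F B j (g y) = y := LinearMap.congr_fun hg y
    rw [Bop_apply] at h1
    rw [← h1]
    refine Finset.sum_congr rfl fun i _ => ?_
    rw [← map_smul]
    simp [G, smul_smul, (hc i).ne', h1]
  have h2 : d j * ⟪U j y, y⟫ ≤ ∑ i, c i * ⟪V i (G i y), G i y⟫ := by
    refine le_trans ?_ (hVU fun i => G i y)
    have h3 := Finset.single_le_sum
      (f := fun j' => d j' * ⟪U j' (∑ i, c i • B i j' (G i y)), ∑ i, c i • B i j' (G i y)⟫)
      (fun j _ => mul_nonneg (hd j).le ((hU j).2 _)) (Finset.mem_univ j)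
    simp only [hy] at h3
    exact h3
  have h4 : ∑ i, c i * ⟪V i (G i y), G i y⟫ ≤ (∑ i, c i * ‖G i‖ ^ 2) * ‖y‖ ^ 2 := by
    rw [Finset.sum_mul]
    refine Finset.sum_le_sum fun i _ => ?_
    rw [mul_assoc, ← mul_pow]
    exact mul_le_mul_of_nonneg_left ((hV i _).trans
      (pow_le_pow_left₀ (norm_nonneg _) ((G i).le_opNorm y) 2)) (hc i).le
  rw [mul_assoc, inv_mul_eq_div, le_div_iff₀ hdj]
  nlinarith [sq_nonneg ‖y‖]

/-- Lower bounds on the objective and the determinants of `V`, and upper bounds on the forms of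
`U`, give lower bounds on the determinants of `U`. -/
lemma exists_le_det (hc : ∀ i, 0 < c i) (hd : ∀ j, 0 < d j) (o : ℝ) {κ : ℝ} (hκ : 0 < κ)
    {R : Fin m → ℝ} (j : Fin m) :
    ∃ η, 0 < η ∧ ∀ (V : ∀ i, E i →ₗ[ℝ] E i) (U : ∀ j, F j →ₗ[ℝ] F j),
      (∀ j, PosDef (U j)) → o ≤ objective E F c d V U →
      (∀ i, κ ^ Module.finrank ℝ (E i) ≤ LinearMap.det (V i)) →
      (∀ j y, ⟪U j y, y⟫ ≤ R j * ‖y‖ ^ 2) → η ≤ LinearMap.det (U j) := by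
  set A : Fin m → ℝ := fun j =>
    |Real.log ((Module.finrank ℝ (F j)).factorial * R j ^ Module.finrank ℝ (F j))| with hA
  set q : ℝ := o + ∑ i, c i * (Module.finrank ℝ (E i) * Real.log κ) - ∑ j, d j * A j with hq
  refine ⟨Real.exp (q / d j), Real.exp_pos _, fun V U hU ho hV hR => ?_⟩
  have hlogU : ∀ j, Real.log (LinearMap.det (U j)) ≤ A j := fun j =>
    (Real.log_le_log (hU j).det_pos ((hU j).posSemidef.det_le (hR j))).trans (le_abs_self _)
  have hlogV : ∑ i, c i * (Module.finrank ℝ (E i) * Real.log κ) ≤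
      ∑ i, c i * Real.log (LinearMap.det (V i)) :=
    Finset.sum_le_sum fun i _ => mul_le_mul_of_nonneg_left (by
      rw [← Real.log_pow]
      exact Real.log_le_log (pow_pos hκ _) (hV i)) (hc i).le
  have hsum : d j * (A j - Real.log (LinearMap.det (U j))) ≤
      ∑ j, d j * (A j - Real.log (LinearMap.det (U j))) :=
    Finset.single_le_sum (f := fun j => d j * (A j - Real.log (LinearMap.det (U j))))
      (fun j _ => mul_nonneg (hd j).le (sub_nonneg.2 (hlogU j))) (Finset.mem_univ j)
  simp only [mul_sub, Finset.sum_sub_distrib] at hsum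
  rw [← Real.le_log_iff_exp_le (hU j).det_pos, div_le_iff₀' (hd j)]
  have hA0 : 0 ≤ d j * A j := mul_nonneg (hd j).le (abs_nonneg _)
  rw [objective] at ho
  linarith

variable [∀ i, FiniteDimensional ℝ (E i)]

/-- On a simple datum, feasible pairs with objective at least `o` can be rescaled so that the
eigenvalues of the first component lie in a fixed interval `[κ, 1]`. -/
lemma exists_normalized (hc : ∀ i, 0 < c i) (hd : ∀ j, 0 < d j)
    (hsc : ScalingCond E F c d) (hdim : DimCond E F c d B) (hs : Simple E F c d B) (o : ℝ) :
    ∃ κ, 0 < κ ∧ ∀ (V : ∀ i, E i →ₗ[ℝ] E i) (U : ∀ j, F j →ₗ[ℝ] F j),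
      (∀ i, PosDef (V i)) → (∀ j, PosDef (U j)) → GaussCon E F c d B V U →
      o ≤ objective E F c d V U →
      ∃ (V' : ∀ i, E i →ₗ[ℝ] E i) (U' : ∀ j, F j →ₗ[ℝ] F j),
        (∀ i, PosDef (V' i)) ∧ (∀ j, PosDef (U' j)) ∧ GaussCon E F c d B V' U' ∧
        objective E F c d V' U' = objective E F c d V U ∧
        (∀ i x, ⟪V' i x, x⟫ ≤ ‖x‖ ^ 2) ∧
        ∀ i, κ ^ Module.finrank ℝ (E i) ≤ LinearMap.det (V' i) := by
  obtain ⟨δ, hδ, hgap⟩ := hdim.exists_dimGap hs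
  obtain ⟨C, hC⟩ := exists_objective_le hc hd hsc hdim hδ.le hgap
  refine ⟨Real.exp (-((C - o) / δ)), Real.exp_pos _, fun V U hV hU hVU ho => ?_⟩
  obtain ⟨-, f, ν, hν, hf, hspread⟩ := hC V U hV hU hVU
  obtain ⟨t, ht, ht1, htκ⟩ : ∃ t, 0 < t ∧ (∀ i l, t * ν i l ≤ 1) ∧
      ∀ i l, Real.exp (-((C - o) / δ)) ≤ t * ν i l := by
    rcases isEmpty_or_nonempty (Σ i, Fin (Module.finrank ℝ (E i))) with h | h
    · exact ⟨1, one_pos, fun i l => h.elim ⟨i, l⟩, fun i l => h.elim ⟨i, l⟩⟩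
    · obtain ⟨p, hp⟩ := Finite.exists_max fun p : Σ i, Fin (Module.finrank ℝ (E i)) => ν p.1 p.2
      refine ⟨(ν p.1 p.2)⁻¹, inv_pos.2 (hν _ _), fun i l => ?_, fun i l => ?_⟩
      · exact (inv_mul_le_one₀ (hν _ _)).2 (hp ⟨i, l⟩)
      · have h1 := hspread p ⟨i, l⟩
        have h2 : Real.log (ν p.1 p.2) - Real.log (ν i l) ≤ (C - o) / δ := by
          rw [le_div_iff₀ hδ]
          linarith
        rw [← Real.exp_log (mul_pos (inv_pos.2 (hν p.1 p.2)) (hν i l)),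
          Real.log_mul (inv_pos.2 (hν _ _)).ne' (hν _ _).ne', Real.log_inv, Real.exp_le_exp]
        linarith
  have heig : ∀ i l, (t • V i) (f i l) = (t * ν i l) • f i l := fun i l => by
    rw [LinearMap.smul_apply, hf, smul_smul]
  refine ⟨fun i => t • V i, fun j => t • U j, fun i => (hV i).smul ht, fun j => (hU j).smul ht,
    hVU.smul ht.le, ?_, fun i x => ?_, fun i => ?_⟩
  · rw [objective_smul hV hU ht, ← hsc, sub_self, mul_zero, add_zero]
  · rw [inner_apply_eq_sum_of_eigen (f i) _ (heig i), norm_sq_eq_sum (f i)]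
    exact Finset.sum_le_sum fun l _ => mul_le_of_le_one_left (sq_nonneg _) (ht1 i l)
  · rw [det_eq_prod_of_eigen (f i) _ (heig i)]
    calc _ = ∏ _l : Fin (Module.finrank ℝ (E i)), Real.exp (-((C - o) / δ)) := by simp
      _ ≤ _ := Finset.prod_le_prod (fun _ _ => (Real.exp_pos _).le) fun l _ => htκ i l

/-- The maximum of the objective over feasible pairs is attained on a simple datum. -/
lemma exists_maximizer (hc : ∀ i, 0 < c i) (hd : ∀ j, 0 < d j)
    (hsc : ScalingCond E F c d) (hdim : DimCond E F c d B) (hs : Simple E F c d B) :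
    ∃ (V : ∀ i, E i →ₗ[ℝ] E i) (U : ∀ j, F j →ₗ[ℝ] F j),
      (∀ i, PosDef (V i)) ∧ (∀ j, PosDef (U j)) ∧ GaussCon E F c d B V U ∧
      ∀ (V' : ∀ i, E i →ₗ[ℝ] E i) (U' : ∀ j, F j →ₗ[ℝ] F j),
        (∀ i, PosDef (V' i)) → (∀ j, PosDef (U' j)) → GaussCon E F c d B V' U' →
        objective E F c d V' U' ≤ objective E F c d V U := by
  obtain ⟨V₀, U₀, hV₀, hU₀, h₀⟩ := exists_feasible c d B hc hd
  set o := objective E F c d V₀ U₀ with ho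
  obtain ⟨κ, hκ, hnorm⟩ := exists_normalized hc hd hsc hdim hs o
  choose R hR hUR using fun j => exists_inner_le hc hd (hdim.surjective hsc hd j)
  choose η hη hUη using fun j => exists_le_det (E := E) (F := F) hc hd o hκ (R := R) j
  let K : Set ((∀ i, E i →L[ℝ] E i) × (∀ j, F j →L[ℝ] F j)) :=
    (Set.univ.pi fun i => posBox (E i) 1 (κ ^ Module.finrank ℝ (E i))) ×ˢ
      (Set.univ.pi fun j => posBox (F j) (R j) (η j)) ∩
    {p | GaussCon E F c d B (fun i => p.1 i) fun j => p.2 j}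
  have hKcompact : IsCompact K := by
    refine ((isCompact_univ_pi fun i => isCompact_posBox zero_le_one).prod
      (isCompact_univ_pi fun j => isCompact_posBox (hR j).le)).inter_right ?_
    simp only [GaussCon, ContinuousLinearMap.coe_coe, Set.ofPred_forall]
    exact isClosed_iInter fun x => isClosed_le (by fun_prop) (by fun_prop)
  have hKV : ∀ p ∈ K, ∀ i, 0 < LinearMap.det (p.1 i : E i →ₗ[ℝ] E i) := fun p hp i =>
    (pow_pos hκ _).trans_le (hp.1.1 i trivial).2.2
  have hKU : ∀ p ∈ K, ∀ j, 0 < LinearMap.det (p.2 j : F j →ₗ[ℝ] F j) := fun p hp j =>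
    (hη j).trans_le (hp.1.2 j trivial).2.2
  have hcont : ContinuousOn (fun p : (∀ i, E i →L[ℝ] E i) × (∀ j, F j →L[ℝ] F j) =>
      objective E F c d (fun i => p.1 i) fun j => p.2 j) K := by
    refine ContinuousOn.sub (continuousOn_finsetSum _ fun j _ => ?_)
      (continuousOn_finsetSum _ fun i _ => ?_)
    · refine continuousOn_const.mul (ContinuousOn.log ?_ fun p hp => (hKU p hp j).ne')
      exact (ContinuousLinearMap.continuous_det.comp (by fun_prop :
        Continuous fun p : (∀ i, E i →L[ℝ] E i) × (∀ j, F j →L[ℝ] F j) => p.2 j)).continuousOn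
    · refine continuousOn_const.mul (ContinuousOn.log ?_ fun p hp => (hKV p hp i).ne')
      exact (ContinuousLinearMap.continuous_det.comp (by fun_prop :
        Continuous fun p : (∀ i, E i →L[ℝ] E i) × (∀ j, F j →L[ℝ] F j) => p.1 i)).continuousOn
  have hmem : ∀ (V : ∀ i, E i →ₗ[ℝ] E i) (U : ∀ j, F j →ₗ[ℝ] F j),
      (∀ i, PosDef (V i)) → (∀ j, PosDef (U j)) → GaussCon E F c d B V U →
      o ≤ objective E F c d V U →
      ∃ p ∈ K, objective E F c d (fun i => p.1 i) (fun j => p.2 j) =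
        objective E F c d V U := by
    intro V U hV hU hVU hle
    obtain ⟨V', U', hV', hU', hVU', hobj, hle1, hdet⟩ := hnorm V U hV hU hVU hle
    have hUle : ∀ j y, ⟪U' j y, y⟫ ≤ R j * ‖y‖ ^ 2 := fun j =>
      hUR j V' U' (fun j => (hU' j).posSemidef) hVU' hle1
    refine ⟨(fun i => (V' i).toContinuousLinearMap, fun j => (U' j).toContinuousLinearMap),
      ⟨⟨fun i _ => ⟨(hV' i).posSemidef, fun x => ?_, hdet i⟩,
        fun j _ => ⟨(hU' j).posSemidef, hUle j, ?_⟩⟩, hVU'⟩, hobj⟩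
    · simpa using hle1 i x
    · exact hUη j V' U' hU' (hobj ▸ hle) hdet hUle
  obtain ⟨p₀, hp₀, -⟩ := hmem V₀ U₀ hV₀ hU₀ h₀ le_rfl
  obtain ⟨p, hp, hmax⟩ := hKcompact.exists_isMaxOn ⟨p₀, hp₀⟩ hcont
  have hbest : ∀ (V : ∀ i, E i →ₗ[ℝ] E i) (U : ∀ j, F j →ₗ[ℝ] F j),
      (∀ i, PosDef (V i)) → (∀ j, PosDef (U j)) → GaussCon E F c d B V U →
      o ≤ objective E F c d V U →
      objective E F c d V U ≤ objective E F c d (fun i => p.1 i) fun j => p.2 j := by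
    intro V U hV hU hVU hle
    obtain ⟨q, hq, hqobj⟩ := hmem V U hV hU hVU hle
    rw [← hqobj]
    exact hmax hq
  refine ⟨fun i => p.1 i, fun j => p.2 j, fun i => (hp.1.1 i trivial).1.posDef (hKV p hp i).ne',
    fun j => (hp.1.2 j trivial).1.posDef (hKU p hp j).ne', hp.2, fun V U hV hU hVU => ?_⟩
  rcases le_total o (objective E F c d V U) with h | h
  · exact hbest V U hV hU hVU h
  · exact h.trans (hbest V₀ U₀ hV₀ hU₀ h₀ le_rfl)

lemma gaussExt_of_simple (hc : ∀ i, 0 < c i) (hd : ∀ j, 0 < d j)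
    (hsc : ScalingCond E F c d) (hdim : DimCond E F c d B) (hs : Simple E F c d B) :
    GaussExt E F c d B := by
  obtain ⟨V, U, hV, hU, hVU, hmax⟩ := exists_maximizer hc hd hsc hdim hs
  refine ⟨V, U, hV, hU, hVU, le_antisymm (sSup_le ?_) (le_sSup ⟨V, U, hV, hU, hVU, rfl⟩)⟩
  rintro _ ⟨V', U', hV', hU', hVU', rfl⟩
  exact EReal.coe_le_coe (div_le_div_of_nonneg_right (hmax V' U' hV' hU' hVU') zero_le_two)

lemma Dg_lt_top (hc : ∀ i, 0 < c i) (hd : ∀ j, 0 < d j)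
    (hsc : ScalingCond E F c d) (hdim : DimCond E F c d B) : Dg E F c d B < ⊤ := by
  obtain ⟨C, hC⟩ := exists_objective_le hc hd hsc hdim le_rfl hdim.dimGap_zero
  refine (sSup_le ?_).trans_lt (EReal.coe_lt_top (C / 2))
  rintro _ ⟨V, U, hV, hU, hVU, rfl⟩
  exact EReal.coe_le_coe (div_le_div_of_nonneg_right (hC V U hV hU hVU).1 zero_le_two)

end Extremizers

end FRBL

namespace FRBL

variable {k m : ℕ}
  (E : Fin k → Type*) (F : Fin m → Type*)
  [∀ i, NormedAddCommGroup (E i)] [∀ i, InnerProductSpace ℝ (E i)]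
  [∀ i, FiniteDimensional ℝ (E i)]
  [∀ i, MeasurableSpace (E i)] [∀ i, BorelSpace (E i)]
  [∀ j, NormedAddCommGroup (F j)] [∀ j, InnerProductSpace ℝ (F j)]
  [∀ j, FiniteDimensional ℝ (F j)]
  [∀ j, MeasurableSpace (F j)] [∀ j, BorelSpace (F j)]

/-- **Theorem (conditions for finiteness and gaussian-extremizability).**
`D_g(c,d,B)` is finite if and only if the scaling condition and the dimension condition
over product-form subspaces hold; in particular these conditions imply that each `B_j`
is surjective.  Moreover, if the datum is in addition simple, then it is
gaussian-extremizable. -/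
theorem Dg_finite_iff
    (c : Fin k → ℝ) (d : Fin m → ℝ) (B : ∀ i j, E i →ₗ[ℝ] F j)
    (hc : ∀ i, 0 < c i) (hd : ∀ j, 0 < d j) :
    ((⊥ < Dg E F c d B ∧ Dg E F c d B < ⊤) ↔
      (ScalingCond E F c d ∧ DimCond E F c d B)) ∧
    (ScalingCond E F c d → DimCond E F c d B →
      ∀ j, Function.Surjective (Bop E F B j)) ∧
    (ScalingCond E F c d → DimCond E F c d B → Simple E F c d B →
      GaussExt E F c d B) := by
  refine ⟨⟨fun h => ?_, fun h => ⟨bot_lt_Dg hc hd, Dg_lt_top hc hd h.1 h.2⟩⟩,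
    fun hsc hdim => hdim.surjective hsc hd, fun hsc hdim hs => gaussExt_of_simple hc hd hsc hdim hs⟩
  obtain ⟨M, hM⟩ := exists_objective_le_of_Dg_lt_top h.2
  exact ⟨scalingCond_of_objective_le hc hd hM, dimCond_of_objective_le hc hd hM⟩

end FRBL
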